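/- Let p ∈ (0,1) and let (S_n, K_n)_{n≥0} be a random trie pair family with parameter p. Let Σ̂_n denote the 2×2 covariance matrix of the vector (S_n, K_n), i.e., Σ̂_n = [[Var(S_n), Cov(S_n,K_n)],[Cov(S_n,K_n), Var(K_n)]]. Then Σ̂_n is positive definite for all sufficiently large n, and Σ̂_n^{−1/2} (S_n − E(S_n), K_n − E(K_n))ᵀ converges in distribution, as n → ∞, to a centered bivariate Gaussian with covariance matrix the 2×2 identity, where Σ̂_n^{−1/2} denotes the inverse of the unique positive-definite square root of Σ̂_n. -/

import Mathlib

open MeasureTheory ProbabilityTheory Filter Topology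

noncomputable def binomialMeasure (n : ℕ) (p : ℝ) : Measure ℕ :=
  ∑ k ∈ Finset.range (n + 1),
    (ENNReal.ofReal ((n.choose k : ℝ) * p ^ k * (1 - p) ^ (n - k))) • Measure.dirac k

/-- The combination map `(B, (S',K')_j, (S'',K'')_j) ↦ (S'_B + S''_{n-B} + 1, K'_B + K''_{n-B} + n)`. -/
def trieStep (n : ℕ) (ω : ℕ × ((ℕ → ℕ × ℕ) × (ℕ → ℕ × ℕ))) : ℕ × ℕ :=
  ((ω.2.1 ω.1).1 + (ω.2.2 (n - ω.1)).1 + 1,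
   (ω.2.1 ω.1).2 + (ω.2.2 (n - ω.1)).2 + n)

/-- A random trie pair family with parameter `p`, given by the joint laws
`μ n` of `(S_n, K_n)` on `ℕ × ℕ`. -/
structure IsTriePairFamily (p : ℝ) (μ : ℕ → Measure (ℕ × ℕ)) : Prop where
  prob : ∀ n, IsProbabilityMeasure (μ n)
  moments : ∀ n r : ℕ, Integrable (fun x : ℕ × ℕ => ((x.1 : ℝ) + (x.2 : ℝ)) ^ r) (μ n)
  init0 : μ 0 = Measure.dirac (0, 0)
  init1 : μ 1 = Measure.dirac (0, 0)
  recur : ∀ n, 2 ≤ n → ∃ P : Measure (ℕ × ((ℕ → ℕ × ℕ) × (ℕ → ℕ × ℕ))),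
    IsProbabilityMeasure P ∧
    P.map Prod.fst = binomialMeasure n p ∧
    (∀ j, P.map (fun ω => ω.2.1 j) = μ j) ∧
    (∀ j, P.map (fun ω => ω.2.2 j) = μ j) ∧
    P = (P.map Prod.fst).prod
          ((P.map (fun ω => ω.2.1)).prod (P.map (fun ω => ω.2.2))) ∧
    μ n = P.map (trieStep n)

noncomputable def eS (μ : ℕ → Measure (ℕ × ℕ)) (n : ℕ) : ℝ := ∫ x, (x.1 : ℝ) ∂ μ n

noncomputable def eK (μ : ℕ → Measure (ℕ × ℕ)) (n : ℕ) : ℝ := ∫ x, (x.2 : ℝ) ∂ μ n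

noncomputable def varS (μ : ℕ → Measure (ℕ × ℕ)) (n : ℕ) : ℝ :=
  ∫ x, ((x.1 : ℝ) - eS μ n) ^ 2 ∂ μ n

noncomputable def varK (μ : ℕ → Measure (ℕ × ℕ)) (n : ℕ) : ℝ :=
  ∫ x, ((x.2 : ℝ) - eK μ n) ^ 2 ∂ μ n

noncomputable def covSK (μ : ℕ → Measure (ℕ × ℕ)) (n : ℕ) : ℝ :=
  ∫ x, ((x.1 : ℝ) - eS μ n) * ((x.2 : ℝ) - eK μ n) ∂ μ n

/-- The probability that a binomial variable with parameters `n`, `p` equals `k`. -/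
noncomputable def binWeight (p : ℝ) (n k : ℕ) : ℝ := (n.choose k : ℝ) * p ^ k * (1 - p) ^ (n - k)

/-- Expectation of `g` under the binomial distribution with parameters `n`, `p`. -/
noncomputable def binE {E : Type*} [AddCommGroup E] [Module ℝ E] (p : ℝ) (n : ℕ) (g : ℕ → E) : E :=
  ∑ k ∈ Finset.range (n + 1), binWeight p n k • g k

lemma binWeight_nonneg {p : ℝ} (hp0 : 0 ≤ p) (hp1 : p ≤ 1) (n k : ℕ) : 0 ≤ binWeight p n k := by
  have : 0 ≤ 1 - p := by linarith
  unfold binWeight; positivity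

lemma binWeight_eq_zero {p : ℝ} {n k : ℕ} (h : n < k) : binWeight p n k = 0 := by
  simp [binWeight, Nat.choose_eq_zero_of_lt h]

lemma binWeight_succ_zero (p : ℝ) (n : ℕ) :
    binWeight p (n + 1) 0 = (1 - p) * binWeight p n 0 := by
  simp [binWeight, pow_succ']

lemma binWeight_succ_succ (p : ℝ) {n k : ℕ} (hk : k ≤ n) :
    binWeight p (n + 1) (k + 1) = p * binWeight p n k + (1 - p) * binWeight p n (k + 1) := by
  rcases hk.eq_or_lt with rfl | hlt
  · simp [binWeight, pow_succ']
  · obtain ⟨d, rfl⟩ := Nat.exists_eq_add_of_lt hlt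
    have h1 : k + d + 1 + 1 - (k + 1) = d + 1 := by omega
    have h2 : k + d + 1 - k = d + 1 := by omega
    have h3 : k + d + 1 - (k + 1) = d := by omega
    simp only [binWeight, Nat.choose_succ_succ' (k + d + 1) k, h1, h2, h3]
    push_cast
    ring

section BinE

variable {E : Type*} [AddCommGroup E] [Module ℝ E]

lemma binE_zero (p : ℝ) (g : ℕ → E) : binE p 0 g = g 0 := by
  simp [binE, binWeight]

lemma binE_succ (p : ℝ) (n : ℕ) (g : ℕ → E) :
    binE p (n + 1) g = p • binE p n (fun k => g (k + 1)) + (1 - p) • binE p n g := by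
  have h1 : binE p n g =
      ∑ k ∈ Finset.range (n + 1), binWeight p n (k + 1) • g (k + 1) + binWeight p n 0 • g 0 := by
    rw [binE, Finset.sum_range_succ', Finset.sum_range_succ, binWeight_eq_zero (Nat.lt_succ_self n)]
    simp
  rw [h1, binE, Finset.sum_range_succ', binWeight_succ_zero, binE, smul_add, Finset.smul_sum,
    Finset.smul_sum, ← add_assoc, ← Finset.sum_add_distrib, smul_smul]
  congr 1
  refine Finset.sum_congr rfl fun k hk => ?_
  rw [binWeight_succ_succ p (by simpa [Nat.lt_succ_iff] using hk), add_smul, smul_smul, smul_smul]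

lemma binE_congr {p : ℝ} {n : ℕ} {g h : ℕ → E} (H : ∀ k ≤ n, g k = h k) :
    binE p n g = binE p n h :=
  Finset.sum_congr rfl fun k hk => by rw [H k (by simpa [Nat.lt_succ_iff] using hk)]

lemma binE_add (p : ℝ) (n : ℕ) (g h : ℕ → E) :
    binE p n (fun k => g k + h k) = binE p n g + binE p n h := by
  simp [binE, smul_add, Finset.sum_add_distrib]

lemma binE_sub (p : ℝ) (n : ℕ) (g h : ℕ → E) :
    binE p n (fun k => g k - h k) = binE p n g - binE p n h := by
  simp [binE, smul_sub, Finset.sum_sub_distrib]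

lemma binE_reflect (p : ℝ) (n : ℕ) (g : ℕ → E) :
    binE p n (fun k => g (n - k)) = binE (1 - p) n g := by
  rw [binE, ← Finset.sum_range_reflect, binE]
  refine Finset.sum_congr rfl fun k hk => ?_
  have hk : k ≤ n := by simpa [Nat.lt_succ_iff] using hk
  have h1 : n + 1 - 1 - k = n - k := by omega
  have h2 : n - (n - k) = k := by omega
  rw [h1, h2, binWeight, binWeight, h2, Nat.choose_symm hk, sub_sub_cancel]
  congr 1
  ring

end BinE

lemma sum_binWeight (p : ℝ) (n : ℕ) : ∑ k ∈ Finset.range (n + 1), binWeight p n k = 1 := by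
  have h := add_pow p (1 - p) n
  rw [add_sub_cancel, one_pow] at h
  rw [h]
  exact Finset.sum_congr rfl fun k _ => by rw [binWeight]; ring

lemma binE_const {E : Type*} [AddCommGroup E] [Module ℝ E] (p : ℝ) (n : ℕ) (c : E) :
    binE p n (fun _ => c) = c := by
  rw [binE, ← Finset.sum_smul, sum_binWeight, one_smul]

lemma binE_mul_left (p : ℝ) (n : ℕ) (c : ℝ) (g : ℕ → ℝ) :
    binE p n (fun k => c * g k) = c * binE p n g := by
  simp only [binE, Finset.mul_sum, smul_eq_mul]
  exact Finset.sum_congr rfl fun k _ => by ring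

lemma binE_mul_left_complex (p : ℝ) (n : ℕ) (c : ℂ) (g : ℕ → ℂ) :
    binE p n (fun k => c * g k) = c * binE p n g := by
  simp only [binE, Finset.mul_sum, Complex.real_smul]
  exact Finset.sum_congr rfl fun k _ => by ring

lemma binE_ofReal (p : ℝ) (n : ℕ) (g : ℕ → ℝ) :
    binE p n (fun k => (g k : ℂ)) = (binE p n g : ℝ) := by
  simp [binE]

lemma binE_mono {p : ℝ} (hp0 : 0 ≤ p) (hp1 : p ≤ 1) {n : ℕ} {g h : ℕ → ℝ}
    (H : ∀ k ≤ n, g k ≤ h k) : binE p n g ≤ binE p n h :=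
  Finset.sum_le_sum fun k hk =>
    mul_le_mul_of_nonneg_left (H k (by simpa [Nat.lt_succ_iff] using hk))
      (binWeight_nonneg hp0 hp1 n k)

lemma binE_nonneg {p : ℝ} (hp0 : 0 ≤ p) (hp1 : p ≤ 1) {n : ℕ} {g : ℕ → ℝ}
    (H : ∀ k ≤ n, 0 ≤ g k) : 0 ≤ binE p n g := by
  simpa [binE_const] using binE_mono hp0 hp1 (g := fun _ => 0) H

lemma norm_binE_le {E : Type*} [NormedAddCommGroup E] [NormedSpace ℝ E] {p : ℝ} (hp0 : 0 ≤ p)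
    (hp1 : p ≤ 1) (n : ℕ) (g : ℕ → E) : ‖binE p n g‖ ≤ binE p n (fun k => ‖g k‖) := by
  refine (norm_sum_le _ _).trans (Finset.sum_le_sum fun k _ => ?_)
  rw [norm_smul, Real.norm_of_nonneg (binWeight_nonneg hp0 hp1 n k), smul_eq_mul]

lemma norm_binE_le_of_le {E : Type*} [NormedAddCommGroup E] [NormedSpace ℝ E] {p : ℝ} (hp0 : 0 ≤ p)
    (hp1 : p ≤ 1) {n : ℕ} {g : ℕ → E} {h : ℕ → ℝ} (H : ∀ k ≤ n, ‖g k‖ ≤ h k) :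
    ‖binE p n g‖ ≤ binE p n h :=
  (norm_binE_le hp0 hp1 n g).trans (binE_mono hp0 hp1 H)

lemma abs_binE_le_of_le {p : ℝ} (hp0 : 0 ≤ p) (hp1 : p ≤ 1) {n : ℕ} {g h : ℕ → ℝ}
    (H : ∀ k ≤ n, |g k| ≤ h k) : |binE p n g| ≤ binE p n h := by
  rw [← Real.norm_eq_abs]
  exact norm_binE_le_of_le hp0 hp1 H

lemma binWeight_mul_le_binE {p : ℝ} (hp0 : 0 ≤ p) (hp1 : p ≤ 1) {n k : ℕ} (hk : k ≤ n) {g : ℕ → ℝ}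
    (H : ∀ k ≤ n, 0 ≤ g k) : binWeight p n k * g k ≤ binE p n g :=
  Finset.single_le_sum (f := fun k => binWeight p n k • g k)
    (fun j hj => mul_nonneg (binWeight_nonneg hp0 hp1 n j)
      (H j (by simpa [Nat.lt_succ_iff] using hj)))
    (by simpa [Nat.lt_succ_iff] using hk)

lemma binE_centered (p : ℝ) (n : ℕ) : binE p n (fun k => (k : ℝ) - n * p) = 0 := by
  induction n with
  | zero => simp [binE_zero]
  | succ n ih =>
    have h1 : (fun k : ℕ => ((k + 1 : ℕ) : ℝ) - (n + 1 : ℕ) * p) =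
        fun k : ℕ => ((k : ℝ) - n * p) + (1 - p) := by ext k; push_cast; ring
    have h2 : (fun k : ℕ => (k : ℝ) - (n + 1 : ℕ) * p) =
        fun k : ℕ => ((k : ℝ) - n * p) + (-p) := by ext k; push_cast; ring
    rw [binE_succ, h1, h2, binE_add, binE_add, ih, binE_const, binE_const]
    simp only [smul_eq_mul]; ring

lemma binE_centered_sq (p : ℝ) (n : ℕ) :
    binE p n (fun k => ((k : ℝ) - n * p) ^ 2) = n * p * (1 - p) := by
  induction n with
  | zero => simp [binE_zero]
  | succ n ih =>
    have h1 : (fun k : ℕ => (((k + 1 : ℕ) : ℝ) - (n + 1 : ℕ) * p) ^ 2) =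
        fun k : ℕ => (((k : ℝ) - n * p) ^ 2 + (2 * (1 - p)) * ((k : ℝ) - n * p)) + (1 - p) ^ 2 := by
      ext k; push_cast; ring
    have h2 : (fun k : ℕ => ((k : ℝ) - (n + 1 : ℕ) * p) ^ 2) =
        fun k : ℕ => (((k : ℝ) - n * p) ^ 2 + (-(2 * p)) * ((k : ℝ) - n * p)) + p ^ 2 := by
      ext k; push_cast; ring
    rw [binE_succ, h1, h2, binE_add, binE_add, binE_add, binE_add, binE_mul_left, binE_mul_left, ih,
      binE_const, binE_const, binE_centered]
    simp only [smul_eq_mul]; push_cast; ring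

lemma binE_id (p : ℝ) (n : ℕ) : binE p n (fun k => (k : ℝ)) = n * p := by
  have h := binE_centered p n
  rw [binE_sub, binE_const] at h
  linarith

lemma binE_inv_le {p : ℝ} (hp0 : 0 < p) (hp1 : p < 1) (n : ℕ) :
    p * binE p n (fun k => 1 / ((k : ℝ) + 1)) ≤ 1 / ((n : ℝ) + 1) := by
  have key : ∀ k ∈ Finset.range (n + 1), (n + 1) * (p * (binWeight p n k • (1 / ((k : ℝ) + 1)))) =
      binWeight p (n + 1) (k + 1) := by
    intro k hk
    have h := Nat.add_one_mul_choose_eq n k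
    have h' : ((n : ℝ) + 1) * n.choose k = (n + 1).choose (k + 1) * (k + 1) := by exact_mod_cast h
    have h1 : n + 1 - (k + 1) = n - k := by omega
    rw [binWeight, binWeight, h1, smul_eq_mul]
    have : (k : ℝ) + 1 ≠ 0 := by positivity
    field_simp
    linear_combination p ^ (k + 1) * (1 - p) ^ (n - k) * h'
  rw [le_div_iff₀ (by positivity), mul_comm, binE, Finset.mul_sum, Finset.mul_sum,
    Finset.sum_congr rfl key]
  have := sum_binWeight p (n + 1)
  rw [Finset.sum_range_succ'] at this
  linarith [binWeight_nonneg hp0.le hp1.le (n + 1) 0]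

lemma binE_inv_reflect_le {p : ℝ} (hp0 : 0 < p) (hp1 : p < 1) (n : ℕ) :
    (1 - p) * binE p n (fun k => 1 / (((n - k : ℕ) : ℝ) + 1)) ≤ 1 / ((n : ℝ) + 1) := by
  rw [binE_reflect p n (fun k => 1 / ((k : ℝ) + 1))]
  exact binE_inv_le (by linarith) (by linarith) n

lemma binE_cexp (p : ℝ) (n : ℕ) (z : ℂ) :
    binE p n (fun k => Complex.exp (z * ((k : ℂ) - n * p))) =
      (p * Complex.exp (z * (1 - p)) + (1 - p) * Complex.exp (-(z * p))) ^ n := by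
  induction n with
  | zero => simp [binE_zero]
  | succ n ih =>
    have h1 : (fun k : ℕ => Complex.exp (z * (((k + 1 : ℕ) : ℂ) - (n + 1 : ℕ) * p))) =
        fun k : ℕ => Complex.exp (z * (1 - p)) * Complex.exp (z * ((k : ℂ) - n * p)) := by
      ext k; rw [← Complex.exp_add]; push_cast; ring_nf
    have h2 : (fun k : ℕ => Complex.exp (z * ((k : ℂ) - (n + 1 : ℕ) * p))) =
        fun k : ℕ => Complex.exp (-(z * p)) * Complex.exp (z * ((k : ℂ) - n * p)) := by
      ext k; rw [← Complex.exp_add]; push_cast; ring_nf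
    rw [binE_succ, h1, h2, binE_mul_left_complex, binE_mul_left_complex, ih]
    simp only [Complex.real_smul]; push_cast; ring

lemma binE_exp_le {p : ℝ} (hp0 : 0 ≤ p) (hp1 : p ≤ 1) (n : ℕ) {s : ℝ} (hs : |s| ≤ 1) :
    binE p n (fun k => Real.exp (s * ((k : ℝ) - n * p))) ≤ Real.exp (n * s ^ 2) := by
  have hexp : ∀ x : ℝ, |x| ≤ 1 → Real.exp x ≤ 1 + x + x ^ 2 := fun x hx => by
    have := Real.abs_exp_sub_one_sub_id_le hx
    linarith [(abs_le.1 this).2]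
  have h : binE p n (fun k => Real.exp (s * ((k : ℝ) - n * p))) =
      (p * Real.exp (s * (1 - p)) + (1 - p) * Real.exp (-(s * p))) ^ n := by
    have := binE_cexp p n (s : ℂ)
    rw [← Complex.ofReal_inj, ← binE_ofReal]
    push_cast
    exact this
  have h1 := hexp (s * (1 - p)) (by
    rw [abs_mul, abs_of_nonneg (by linarith : 0 ≤ 1 - p)]; nlinarith [abs_nonneg s])
  have h2 := hexp (-(s * p)) (by rw [abs_neg, abs_mul, abs_of_nonneg hp0]; nlinarith [abs_nonneg s])
  rw [h, Real.exp_nat_mul]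
  have hq : 0 ≤ 1 - p := by linarith
  refine pow_le_pow_left₀ (by positivity) ?_ n
  calc _ ≤ p * (1 + s * (1 - p) + (s * (1 - p)) ^ 2) + (1 - p) * (1 + -(s * p) + (-(s * p)) ^ 2) := by
        gcongr
    _ = 1 + p * (1 - p) * s ^ 2 := by ring
    _ ≤ s ^ 2 + 1 := by nlinarith [sq_nonneg s, mul_nonneg hp0 hq]
    _ ≤ _ := Real.add_one_le_exp _

/-- The normalized weight `1 + (k - np)² / n`. -/
noncomputable def binDev (p : ℝ) (n k : ℕ) : ℝ := 1 + ((k : ℝ) - n * p) ^ 2 / n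

lemma one_le_binDev (p : ℝ) (n k : ℕ) : 1 ≤ binDev p n k := by
  unfold binDev; linarith [show 0 ≤ ((k : ℝ) - n * p) ^ 2 / n by positivity]

lemma one_add_sq_pow_three_le (y : ℝ) : (1 + y ^ 2) ^ 3 ≤ 3000 * (Real.exp y + Real.exp (-y)) := by
  have h0 : 4 + 4 * |y| ^ 6 ≥ (1 + |y| ^ 2) ^ 3 := by
    nlinarith [sq_nonneg (|y| ^ 2 - 1), sq_nonneg (|y| ^ 2), sq_nonneg |y|,
      mul_nonneg (sq_nonneg |y|) (sq_nonneg (|y| ^ 2 - 1)),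
      mul_nonneg (add_nonneg zero_le_one (sq_nonneg |y|)) (sq_nonneg (|y| ^ 2 - 1))]
  have h1 : |y| ^ 6 / 720 ≤ Real.exp |y| := by
    simpa [Nat.factorial] using Real.pow_div_factorial_le_exp |y| (abs_nonneg y) 6
  have h2 : Real.exp |y| ≤ Real.exp y + Real.exp (-y) := by
    rcases abs_choice y with h | h <;> rw [h] <;> linarith [Real.exp_pos y, Real.exp_pos (-y)]
  have h3 : 1 ≤ Real.exp |y| := Real.one_le_exp (abs_nonneg y)
  rw [sq_abs] at h0
  linarith

lemma binE_binDev_pow_three_le {p : ℝ} (hp0 : 0 ≤ p) (hp1 : p ≤ 1) {n : ℕ} (hn : 1 ≤ n) :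
    binE p n (fun k => binDev p n k ^ 3) ≤ 6000 * Real.exp 1 := by
  set s : ℝ := 1 / Real.sqrt n with hs
  have hn' : (1 : ℝ) ≤ n := by exact_mod_cast hn
  have hsq : (n : ℝ) * s ^ 2 = 1 := by
    rw [hs, div_pow, Real.sq_sqrt (by positivity)]; field_simp
  have hs1 : |s| ≤ 1 := by
    rw [hs, abs_of_nonneg (by positivity), div_le_one (by positivity)]
    exact Real.one_le_sqrt.2 hn'
  have h1 := binE_exp_le hp0 hp1 n hs1
  have h2 := binE_exp_le hp0 hp1 n (s := -s) (by rwa [abs_neg])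
  rw [neg_sq, hsq] at h2
  rw [hsq] at h1
  calc _ ≤ binE p n (fun k => 3000 * (Real.exp (s * ((k : ℝ) - n * p)) +
        Real.exp (-s * ((k : ℝ) - n * p)))) := by
        refine binE_mono hp0 hp1 fun k _ => ?_
        have : binDev p n k = 1 + (s * ((k : ℝ) - n * p)) ^ 2 := by
          rw [binDev, mul_pow, hs, div_pow, Real.sq_sqrt (by positivity)]; ring
        rw [this, neg_mul]
        exact one_add_sq_pow_three_le _
    _ ≤ _ := by rw [binE_mul_left, binE_add]; linarith

/-- A minimum principle for the binomial splitting recursion. -/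
lemma binE_induction_of_le {p α β : ℝ} (hp0 : 0 < p) (hp1 : p < 1) (hα0 : 0 ≤ α) (hα1 : α ≤ 1)
    (hβ0 : 0 ≤ β) (hβ1 : β ≤ 1) {D : ℕ → ℝ} (h0 : D 0 ≤ 0) (h1 : D 1 ≤ 0)
    {n : ℕ} (hD : ∀ j, 2 ≤ j → j ≤ n → D j ≤ binE p j (fun k => α * D k + β * D (j - k))) :
    D n ≤ 0 := by
  induction n using Nat.strong_induction_on with
  | _ n ih =>
    by_cases hn : n < 2
    · interval_cases n <;> assumption
    push Not at hn
    by_contra! hpos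
    have hq : 0 < 1 - p := by linarith
    have hle : binE p n (fun k => α * D k + β * D (n - k)) ≤
        α * (p ^ n * D n) + β * ((1 - p) ^ n * D n) := by
      rw [binE_add, binE_mul_left, binE_mul_left, binE_reflect p n D]
      have aux : ∀ r : ℝ, 0 ≤ r → r ≤ 1 → binE r n D ≤ r ^ n * D n := by
        intro r hr0 hr1
        rw [binE, Finset.sum_range_succ]
        have : binWeight r n n = r ^ n := by simp [binWeight]
        rw [this, smul_eq_mul]
        have : ∑ k ∈ Finset.range n, binWeight r n k • D k ≤ 0 :=
          Finset.sum_nonpos fun k hk => mul_nonpos_of_nonneg_of_nonpos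
            (binWeight_nonneg hr0 hr1 n k) (ih k (by simpa using hk)
              fun j hj hjk => hD j hj (hjk.trans (Finset.mem_range.1 hk).le))
        linarith
      gcongr
      · exact aux p hp0.le hp1.le
      · exact aux _ hq.le (by linarith)
    have hpn : p ^ n ≤ p ^ 2 := pow_le_pow_of_le_one hp0.le hp1.le hn
    have hqn : (1 - p) ^ n ≤ (1 - p) ^ 2 := pow_le_pow_of_le_one hq.le (by linarith) hn
    have h2 : α * (p ^ n * D n) + β * ((1 - p) ^ n * D n) ≤ p ^ 2 * D n + (1 - p) ^ 2 * D n := by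
      have := mul_le_mul hα1 (mul_le_mul_of_nonneg_right hpn hpos.le) (by positivity) zero_le_one
      have := mul_le_mul hβ1 (mul_le_mul_of_nonneg_right hqn hpos.le) (by positivity) zero_le_one
      linarith
    have := hD n hn le_rfl
    nlinarith [mul_pos (mul_pos hp0 hq) hpos]

lemma binE_induction {p α β : ℝ} (hp0 : 0 < p) (hp1 : p < 1) (hα0 : 0 ≤ α) (hα1 : α ≤ 1)
    (hβ0 : 0 ≤ β) (hβ1 : β ≤ 1) {D : ℕ → ℝ} (h0 : D 0 ≤ 0) (h1 : D 1 ≤ 0)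
    (hD : ∀ n, 2 ≤ n → D n ≤ binE p n (fun k => α * D k + β * D (n - k))) (n : ℕ) : D n ≤ 0 :=
  binE_induction_of_le hp0 hp1 hα0 hα1 hβ0 hβ1 h0 h1 fun j hj _ => hD j hj

lemma binE_succ_sub (p : ℝ) (n : ℕ) (g : ℕ → ℝ) :
    binE p (n + 1) g - binE p n g = p * binE p n (fun k => g (k + 1) - g k) := by
  rw [binE_succ, binE_sub]; simp only [smul_eq_mul]; ring

lemma second_diff_le {p α β : ℝ} (hp0 : 0 < p) (hp1 : p < 1) {m : ℕ → ℝ}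
    (hm : ∀ n, 2 ≤ n → m n = binE p n (fun k => m k + m (n - k)) + (α + β * n)) :
    ∃ C, 0 ≤ C ∧ ∀ n : ℕ, |m (n + 2) - 2 * m (n + 1) + m n| ≤ C / (n + 1) := by
  set d : ℕ → ℝ := fun n => m (n + 2) - 2 * m (n + 1) + m n with hd
  have hq : 0 < 1 - p := by linarith
  have hdiff : ∀ (r : ℝ) (n : ℕ), binE r (n + 2) m - 2 * binE r (n + 1) m + binE r n m =
      r ^ 2 * binE r n d := by
    intro r n
    have h1 := binE_succ_sub r (n + 1) m
    have h2 := binE_succ_sub r n m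
    have h3 := binE_succ_sub r n (fun k => m (k + 1) - m k)
    have h4 : (fun k => m (k + 1 + 1) - m (k + 1) - (m (k + 1) - m k)) = d := by
      ext k; simp only [hd]; ring
    simp only [h4] at h3
    linear_combination h1 - h2 + r * h3
  have hrec : ∀ n, 2 ≤ n → d n = binE p n (fun k => p ^ 2 * d k + (1 - p) ^ 2 * d (n - k)) := by
    intro n hn
    rw [binE_add, binE_mul_left, binE_mul_left, binE_reflect p n d, ← hdiff, ← hdiff]
    have h0 := hm n hn
    have h1 := hm (n + 1) (by omega)
    have h2 := hm (n + 2) (by omega)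
    rw [binE_add, binE_reflect] at h0 h1 h2
    simp only [hd]
    push_cast at h0 h1 h2
    linear_combination h2 - 2 * h1 + h0
  set C := |d 0| + 2 * |d 1| with hC
  have hC0 : 0 ≤ C := by positivity
  have hf : ∀ n : ℕ, binE p n (fun k => p ^ 2 * (C / ((k : ℝ) + 1)) +
      (1 - p) ^ 2 * (C / (((n - k : ℕ) : ℝ) + 1))) ≤ C / (n + 1) := by
    intro n
    have h1 := binE_inv_le hp0 hp1 n
    have h2 := binE_inv_reflect_le hp0 hp1 n
    have h3 : (fun k : ℕ => p ^ 2 * (C / ((k : ℝ) + 1)) +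
      (1 - p) ^ 2 * (C / (((n - k : ℕ) : ℝ) + 1))) = fun k : ℕ => (p ^ 2 * C) * (1 / ((k : ℝ) + 1)) +
        ((1 - p) ^ 2 * C) * (1 / (((n - k : ℕ) : ℝ) + 1)) := by ext k; ring
    rw [h3, binE_add, binE_mul_left, binE_mul_left]
    have h4 := mul_le_mul_of_nonneg_left h1 (mul_nonneg hp0.le hC0)
    have h5 := mul_le_mul_of_nonneg_left h2 (mul_nonneg hq.le hC0)
    calc _ ≤ p * C * (1 / ((n : ℝ) + 1)) + (1 - p) * C * (1 / ((n : ℝ) + 1)) := by linarith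
      _ = _ := by ring
  have key : ∀ s : ℝ, |s| = 1 → ∀ n, s * d n - C / (n + 1) ≤ 0 := by
    intro s hs
    have hle : ∀ x, s * x ≤ |x| := fun x => by
      calc s * x ≤ |s * x| := le_abs_self _
        _ = |x| := by rw [abs_mul, hs, one_mul]
    refine binE_induction hp0 hp1 (sq_nonneg p) (by nlinarith) (sq_nonneg (1 - p)) (by nlinarith)
      (D := fun n => s * d n - C / (n + 1)) ?_ ?_ ?_
    · have := hle (d 0)
      simp only [Nat.cast_zero, zero_add, div_one]
      linarith [abs_nonneg (d 1)]
    · have := hle (d 1)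
      simp only [Nat.cast_one]
      linarith [abs_nonneg (d 0)]
    · intro n hn
      have h1 := hf n
      have h2 : (fun k : ℕ => p ^ 2 * (s * d k - C / ((k : ℝ) + 1)) +
          (1 - p) ^ 2 * (s * d (n - k) - C / (((n - k : ℕ) : ℝ) + 1))) = fun k : ℕ =>
          s * (p ^ 2 * d k + (1 - p) ^ 2 * d (n - k)) - (p ^ 2 * (C / ((k : ℝ) + 1)) +
          (1 - p) ^ 2 * (C / (((n - k : ℕ) : ℝ) + 1))) := by ext k; ring
      rw [h2, binE_sub, binE_mul_left, ← hrec n hn]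
      linarith
  refine ⟨C, hC0, fun n => abs_le.2 ⟨?_, ?_⟩⟩
  · linarith [key (-1) (by simp) n]
  · linarith [key 1 (by simp) n]

/-- The harmonic number `∑_{j < n} 1 / (j + 1)` as a real number. -/
noncomputable def harm (n : ℕ) : ℝ := ∑ j ∈ Finset.range n, 1 / ((j : ℝ) + 1)

lemma harm_succ (n : ℕ) : harm (n + 1) = harm n + 1 / ((n : ℝ) + 1) := Finset.sum_range_succ _ _

lemma harm_nonneg (n : ℕ) : 0 ≤ harm n := Finset.sum_nonneg fun _ _ => by positivity

lemma harm_mono : Monotone harm :=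
  monotone_nat_of_le_succ fun n => by rw [harm_succ]; linarith [show 0 ≤ 1 / ((n : ℝ) + 1) by positivity]

lemma one_le_harm {n : ℕ} (hn : 1 ≤ n) : 1 ≤ harm n := by
  simpa [harm] using harm_mono hn

lemma harm_add_sub_le (j x : ℕ) : harm (j + x) - harm j ≤ x / ((j : ℝ) + 1) := by
  induction x with
  | zero => simp
  | succ x ih =>
    have h : 1 / (((j + x : ℕ) : ℝ) + 1) ≤ 1 / ((j : ℝ) + 1) := by
      gcongr; linarith
    rw [← add_assoc, harm_succ]
    push_cast at h ⊢
    rw [add_div]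
    linarith

lemma mul_harm_add_le (j x : ℕ) : (j : ℝ) * harm (j + x) ≤ ((j : ℝ) + x) * harm j := by
  rcases Nat.eq_zero_or_pos j with rfl | hj
  · simp [harm]
  induction x with
  | zero => simp
  | succ x ih =>
    have h1 := one_le_harm hj
    have h : (j : ℝ) * (1 / (((j + x : ℕ) : ℝ) + 1)) ≤ 1 := by
      rw [mul_one_div, div_le_one (by positivity)]
      push_cast; linarith
    rw [← add_assoc, harm_succ]
    push_cast at h ⊢
    linarith

lemma harm_sq_le (n : ℕ) : harm n ^ 2 ≤ 81 * ((n : ℝ) + 1) ^ (1 / 4 : ℝ) := by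
  have h1 : harm n ≤ 9 * ((n : ℝ) + 1) ^ (1 / 8 : ℝ) := by
    have h2 : harm n ≤ 1 + Real.log n := by
      have := harmonic_le_one_add_log n
      simp only [harmonic] at this
      push_cast at this
      simpa [harm] using this
    have h3 : Real.log n ≤ 8 * ((n : ℝ) + 1) ^ (1 / 8 : ℝ) := by
      have := Real.log_le_rpow_div (x := (n : ℝ) + 1) (by positivity) (ε := 1 / 8) (by norm_num)
      have h4 : Real.log n ≤ Real.log ((n : ℝ) + 1) := by
        rcases Nat.eq_zero_or_pos n with rfl | hn
        · simp
        · exact Real.log_le_log (by exact_mod_cast hn) (by linarith)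
      linarith
    have h5 : (1 : ℝ) ≤ ((n : ℝ) + 1) ^ (1 / 8 : ℝ) :=
      Real.one_le_rpow (by linarith [(Nat.cast_nonneg n : (0 : ℝ) ≤ n)]) (by norm_num)
    linarith
  calc harm n ^ 2 ≤ (9 * ((n : ℝ) + 1) ^ (1 / 8 : ℝ)) ^ 2 :=
        pow_le_pow_left₀ (harm_nonneg n) h1 2
    _ = 81 * ((n : ℝ) + 1) ^ (1 / 4 : ℝ) := by
        rw [mul_pow, ← Real.rpow_natCast (((n : ℝ) + 1) ^ (1 / 8 : ℝ)), ← Real.rpow_mul (by positivity)]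
        norm_num

section SecondDiff

variable {m : ℕ → ℝ} {L : ℝ}

lemma diff_sub_le
    (H : ∀ n : ℕ, |m (n + 2) - 2 * m (n + 1) + m n| ≤ L / (n + 1)) (j x : ℕ) :
    |(m (j + x + 1) - m (j + x)) - (m (j + 1) - m j)| ≤ L * (harm (j + x) - harm j) := by
  induction x with
  | zero => simp
  | succ x ih =>
    have h := H (j + x)
    have e : (m (j + (x + 1) + 1) - m (j + (x + 1))) - (m (j + 1) - m j) =
      ((m (j + x + 1) - m (j + x)) - (m (j + 1) - m j)) +
        (m (j + x + 2) - 2 * m (j + x + 1) + m (j + x)) := by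
      rw [← add_assoc]; ring
    rw [e, ← add_assoc j x 1, harm_succ]
    refine (abs_add_le _ _).trans ?_
    rw [add_sub_right_comm, mul_add, mul_one_div]
    exact add_le_add ih h

lemma diff_le (h0 : m 0 = 0) (h1 : m 1 = 0)
    (H : ∀ n : ℕ, |m (n + 2) - 2 * m (n + 1) + m n| ≤ L / (n + 1)) (k : ℕ) :
    |m (k + 1) - m k| ≤ L * harm k := by
  simpa [h0, h1, harm] using diff_sub_le H 0 k

lemma sub_le_of_diff {B : ℝ} {n : ℕ} (H : ∀ k ≤ n, |m (k + 1) - m k| ≤ B) {k j : ℕ} (hk : k ≤ n)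
    (hj : j ≤ n) : |m k - m j| ≤ B * |(k : ℝ) - j| := by
  wlog hjk : j ≤ k generalizing k j
  · rw [abs_sub_comm, abs_sub_comm (k : ℝ)]; exact this hj hk (by omega)
  obtain ⟨x, rfl⟩ := Nat.exists_eq_add_of_le hjk
  clear hj hjk
  induction x with
  | zero => simp
  | succ x ih =>
    have h1 := ih (by omega)
    have h2 := H (j + x) (by omega)
    rw [← add_assoc]
    have : |m (j + x + 1) - m j| ≤ |m (j + x + 1) - m (j + x)| + |m (j + x) - m j| :=
      abs_sub_le _ _ _
    have e1 : |((j + x : ℕ) : ℝ) - j| = x := by push_cast; simp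
    have e2 : |((j + x + 1 : ℕ) : ℝ) - j| = x + 1 := by
      rw [show ((j + x + 1 : ℕ) : ℝ) - j = ((x + 1 : ℕ) : ℝ) by push_cast; ring, Nat.abs_cast]
      push_cast; rfl
    rw [e1] at h1
    rw [e2]
    linarith

lemma diff_sub_le_of_le (hL : 0 ≤ L)
    (H : ∀ n : ℕ, |m (n + 2) - 2 * m (n + 1) + m n| ≤ L / (n + 1)) {n k k₀ : ℕ} (hn : 1 ≤ n)
    (hk₀ : k₀ ≤ n) :
    |(m (k + 1) - m k) - (m (k₀ + 1) - m k₀)| ≤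
      2 * L * harm n * (|(k : ℝ) - k₀| / ((k₀ : ℝ) + 1)) := by
  have hn1 := one_le_harm hn
  rcases le_total k₀ k with h | h
  · obtain ⟨x, rfl⟩ := Nat.exists_eq_add_of_le h
    refine (diff_sub_le H k₀ x).trans ?_
    have e : |((k₀ + x : ℕ) : ℝ) - k₀| = x := by push_cast; rw [add_sub_cancel_left]; simp
    rw [e]
    refine (mul_le_mul_of_nonneg_left (harm_add_sub_le k₀ x) hL).trans ?_
    have : 0 ≤ L * (x / ((k₀ : ℝ) + 1)) := by positivity
    nlinarith
  · obtain ⟨x, rfl⟩ := Nat.exists_eq_add_of_le h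
    rw [abs_sub_comm]
    refine (diff_sub_le H k x).trans ?_
    have e : |(k : ℝ) - ((k + x : ℕ) : ℝ)| = x := by
      push_cast; rw [show (k : ℝ) - (k + x) = -x by ring]; simp
    rw [e]
    have h1 := mul_harm_add_le k x
    have h2 : harm (k + x) ≤ harm n := harm_mono hk₀
    have h3 : harm (k + x) - harm k ≤ 2 * harm n * (x / (((k + x : ℕ) : ℝ) + 1)) := by
      rw [mul_div_assoc', le_div_iff₀ (by positivity)]
      rcases Nat.eq_zero_or_pos x with rfl | hx
      · simp
      have hx' : (1 : ℝ) ≤ x := by exact_mod_cast hx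
      have h4 : (harm (k + x) - harm k) * ((k : ℝ) + x) ≤ harm (k + x) * x := by linarith
      have h5 : 0 ≤ harm (k + x) - harm k := sub_nonneg.2 (harm_mono (by omega))
      have h6 : harm (k + x) - harm k ≤ (harm (k + x) - harm k) * ((k : ℝ) + x) := by
        nlinarith [(Nat.cast_nonneg k : (0 : ℝ) ≤ k)]
      have h7 : harm (k + x) * x ≤ harm n * x := by gcongr
      push_cast
      linarith
    calc _ ≤ L * (2 * harm n * (x / (((k + x : ℕ) : ℝ) + 1))) := by gcongr
      _ = _ := by ring

lemma taylor_le (hL : 0 ≤ L)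
    (H : ∀ n : ℕ, |m (n + 2) - 2 * m (n + 1) + m n| ≤ L / (n + 1)) (k k₀ : ℕ) :
    |m k - m k₀ - (m (k₀ + 1) - m k₀) * ((k : ℝ) - k₀)| ≤
      2 * L * (((k : ℝ) - k₀) ^ 2 / ((k₀ : ℝ) + 1)) := by
  rcases le_total k₀ k with h | h
  · obtain ⟨x, rfl⟩ := Nat.exists_eq_add_of_le h
    have key : |m (k₀ + x) - m k₀ - (m (k₀ + 1) - m k₀) * x| ≤ L * ((x : ℝ) ^ 2 / ((k₀ : ℝ) + 1)) := by
      clear h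
      induction x with
      | zero => simp
      | succ x ih =>
        have h1 := (diff_sub_le H k₀ x).trans
          (mul_le_mul_of_nonneg_left (harm_add_sub_le k₀ x) hL)
        have e : m (k₀ + (x + 1)) - m k₀ - (m (k₀ + 1) - m k₀) * ((x + 1 : ℕ) : ℝ) =
          (m (k₀ + x) - m k₀ - (m (k₀ + 1) - m k₀) * x) +
            ((m (k₀ + x + 1) - m (k₀ + x)) - (m (k₀ + 1) - m k₀)) := by
          rw [← add_assoc]; push_cast; ring
        rw [e]
        refine (abs_add_le _ _).trans ((add_le_add ih h1).trans ?_)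
        rw [← mul_add, ← add_div]
        gcongr
        push_cast
        nlinarith [(Nat.cast_nonneg x : (0 : ℝ) ≤ x)]
    have e : ((k₀ + x : ℕ) : ℝ) - k₀ = x := by push_cast; ring
    rw [e]
    have : 0 ≤ L * ((x : ℝ) ^ 2 / ((k₀ : ℝ) + 1)) := by positivity
    linarith
  · obtain ⟨x, rfl⟩ := Nat.exists_eq_add_of_le h
    have e : (k : ℝ) - ((k + x : ℕ) : ℝ) = -x := by push_cast; ring
    rw [e]
    clear h e
    induction x with
    | zero => simp
    | succ x ih =>
      have h1 := H (k + x)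
      have e : m k - m (k + (x + 1)) - (m (k + (x + 1) + 1) - m (k + (x + 1))) * (-((x + 1 : ℕ) : ℝ)) =
          (m k - m (k + x) - (m (k + x + 1) - m (k + x)) * (-x)) +
            (m (k + x + 2) - 2 * m (k + x + 1) + m (k + x)) * (x + 1) := by
        rw [← add_assoc]; push_cast; ring
      rw [e]
      refine (abs_add_le _ _).trans ((add_le_add_left ih _).trans ?_)
      rw [abs_mul, abs_of_nonneg (by positivity : (0 : ℝ) ≤ x + 1)]
      have h2 := mul_le_mul_of_nonneg_right h1 (by positivity : (0 : ℝ) ≤ x + 1)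
      have hx : (0 : ℝ) ≤ x := Nat.cast_nonneg x
      have hk : (0 : ℝ) ≤ k := Nat.cast_nonneg k
      push_cast at h2 ⊢
      have h3 : 2 * ((x : ℝ) ^ 2 / ((k : ℝ) + x + 1)) + (x + 1) / ((k : ℝ) + x + 1) ≤
          2 * (((x : ℝ) + 1) ^ 2 / ((k : ℝ) + (x + 1) + 1)) := by
        rw [← mul_div_assoc, ← mul_div_assoc, ← add_div,
          div_le_div_iff₀ (by positivity) (by positivity)]
        nlinarith [mul_nonneg hx hx, mul_nonneg hx hk]
      have h4 := mul_le_mul_of_nonneg_left h3 hL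
      have e2 : L / ((k : ℝ) + x + 1) * (x + 1) = L * ((x + 1) / ((k : ℝ) + x + 1)) := by ring
      rw [e2] at h2
      rw [neg_sq, neg_sq]
      linarith

end SecondDiff

lemma exists_center {p : ℝ} (hp0 : 0 < p) (hp1 : p < 1) (n : ℕ) :
    ∃ k₀ ≤ n, n * p ≤ (k₀ : ℝ) + 1 ∧ n * (1 - p) ≤ ((n - k₀ : ℕ) : ℝ) + 1 ∧
      |(k₀ : ℝ) - n * p| ≤ 1 := by
  have hn : (0 : ℝ) ≤ n := Nat.cast_nonneg n
  have h1 := Nat.floor_le (by positivity : 0 ≤ n * p)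
  have h2 := Nat.lt_floor_add_one (n * p)
  have h3 : ⌊n * p⌋₊ ≤ n := by
    have : (⌊n * p⌋₊ : ℝ) ≤ n := by nlinarith
    exact_mod_cast this
  refine ⟨⌊n * p⌋₊, h3, h2.le, ?_, abs_le.2 ⟨by linarith, by linarith⟩⟩
  rw [Nat.cast_sub h3]
  linarith

lemma sq_sub_center_le {p : ℝ} {n k₀ : ℕ} (h : |(k₀ : ℝ) - n * p| ≤ 1) (k : ℕ) :
    ((k : ℝ) - k₀) ^ 2 ≤ 2 * ((k : ℝ) - n * p) ^ 2 + 2 := by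
  have h1 : ((k₀ : ℝ) - n * p) ^ 2 ≤ 1 := by rw [← sq_abs]; nlinarith [abs_nonneg ((k₀ : ℝ) - n * p)]
  nlinarith [sq_nonneg (((k : ℝ) - n * p) + ((k₀ : ℝ) - n * p))]

lemma binE_sq_sub_center_le {p : ℝ} (hp0 : 0 < p) (hp1 : p < 1) {n k₀ : ℕ} (hn : 1 ≤ n)
    (h : |(k₀ : ℝ) - n * p| ≤ 1) : binE p n (fun k => ((k : ℝ) - k₀) ^ 2) ≤ 3 * n := by
  have hn' : (1 : ℝ) ≤ n := by exact_mod_cast hn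
  calc _ ≤ binE p n (fun k => 2 * ((k : ℝ) - n * p) ^ 2 + 2) :=
        binE_mono hp0.le hp1.le fun k _ => sq_sub_center_le h k
    _ = 2 * (n * p * (1 - p)) + 2 := by rw [binE_add, binE_mul_left, binE_centered_sq, binE_const]
    _ ≤ _ := by nlinarith [sq_nonneg (2 * p - 1), mul_pos hp0 (sub_pos.2 hp1)]

lemma sq_binE_le {p : ℝ} (hp0 : 0 ≤ p) (hp1 : p ≤ 1) (n : ℕ) (g : ℕ → ℝ) :
    binE p n g ^ 2 ≤ binE p n (fun k => g k ^ 2) := by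
  have h : 0 ≤ binE p n (fun k => (g k - binE p n g) ^ 2) :=
    binE_nonneg hp0 hp1 fun k _ => sq_nonneg _
  have e : (fun k => (g k - binE p n g) ^ 2) =
      fun k => (g k ^ 2 - (2 * binE p n g) * g k) + binE p n g ^ 2 := by ext k; ring
  rw [e, binE_add, binE_sub, binE_mul_left, binE_const] at h
  linarith

lemma binE_cov_le {p : ℝ} (hp0 : 0 ≤ p) (hp1 : p ≤ 1) {n : ℕ} {h g x : ℕ → ℝ} {A B c d : ℝ}
    (hA : 0 ≤ A) (hB : 0 ≤ B) (hx : ∀ k, 0 ≤ x k) (hh : ∀ k ≤ n, |h k - c| ≤ A * x k)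
    (hg : ∀ k ≤ n, |g k - d| ≤ B * x k) :
    |binE p n (fun k => h k * g k) - binE p n h * binE p n g| ≤
      2 * (A * B) * binE p n (fun k => x k ^ 2) := by
  have e : binE p n (fun k => h k * g k) - binE p n h * binE p n g =
      binE p n (fun k => (h k - c) * (g k - d)) -
        binE p n (fun k => h k - c) * binE p n (fun k => g k - d) := by
    have e1 : (fun k => (h k - c) * (g k - d)) =
        fun k => ((h k * g k - d * h k) - c * g k) + c * d := by ext k; ring
    rw [e1, binE_add, binE_sub, binE_sub, binE_sub, binE_sub, binE_mul_left, binE_mul_left,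
      binE_const, binE_const, binE_const]
    ring
  have h1 : |binE p n (fun k => (h k - c) * (g k - d))| ≤ A * B * binE p n (fun k => x k ^ 2) := by
    rw [← binE_mul_left]
    refine abs_binE_le_of_le hp0 hp1 fun k hk => ?_
    rw [abs_mul]
    calc _ ≤ (A * x k) * (B * x k) :=
          mul_le_mul (hh k hk) (hg k hk) (abs_nonneg _) (mul_nonneg hA (hx k))
      _ = _ := by ring
  have h2 : |binE p n (fun k => h k - c) * binE p n (fun k => g k - d)| ≤
      A * B * binE p n (fun k => x k ^ 2) := by
    have h3 := abs_binE_le_of_le hp0 hp1 hh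
    have h4 := abs_binE_le_of_le hp0 hp1 hg
    rw [binE_mul_left] at h3 h4
    rw [abs_mul]
    calc _ ≤ (A * binE p n x) * (B * binE p n x) :=
          mul_le_mul h3 h4 (abs_nonneg _) (mul_nonneg hA (binE_nonneg hp0 hp1 fun k _ => hx k))
      _ = A * B * binE p n x ^ 2 := by ring
      _ ≤ _ := by gcongr; exact sq_binE_le hp0 hp1 n x
  rw [e]
  exact (abs_sub _ _).trans (by linarith)

/-- The variance of `m_B + m_{n-B}` for a binomial variable `B`. -/
noncomputable def tollVar (p : ℝ) (m : ℕ → ℝ) (n : ℕ) : ℝ :=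
  binE p n (fun k => (m k + m (n - k)) ^ 2) - binE p n (fun k => m k + m (n - k)) ^ 2

lemma abs_tollVar_succ_sub_le {p L : ℝ} (hp0 : 0 < p) (hp1 : p < 1) {m : ℕ → ℝ} (hL : 0 ≤ L)
    (h0 : m 0 = 0) (h1 : m 1 = 0)
    (H : ∀ n : ℕ, |m (n + 2) - 2 * m (n + 1) + m n| ≤ L / (n + 1)) {n : ℕ} (hn : 1 ≤ n) :
    |tollVar p m (n + 1) - tollVar p m n| ≤ 98 * (L * harm n) ^ 2 := by
  have hq : 0 < 1 - p := by linarith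
  have hn' : (1 : ℝ) ≤ n := by exact_mod_cast hn
  have hK : 0 ≤ L * harm n := mul_nonneg hL (harm_nonneg n)
  set h : ℕ → ℝ := fun k => m k + m (n - k) with hh
  set d₁ : ℕ → ℝ := fun k => m (k + 1) - m k with hd₁
  set d₂ : ℕ → ℝ := fun k => m (n - k + 1) - m (n - k) with hd₂
  set g : ℕ → ℝ := fun k => p * d₁ k + (1 - p) * d₂ k with hg
  have e1 : ∀ F : ℝ → ℝ, binE p (n + 1) (fun k => F (m k + m (n + 1 - k))) =
      p * binE p n (fun k => F (h k + d₁ k)) + (1 - p) * binE p n (fun k => F (h k + d₂ k)) := by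
    intro F
    rw [binE_succ, smul_eq_mul, smul_eq_mul]
    congr 2
    · refine binE_congr fun k hk => ?_
      have : n + 1 - (k + 1) = n - k := by omega
      simp only [this, hh, hd₁]; ring_nf
    · refine binE_congr fun k hk => ?_
      have : n + 1 - k = n - k + 1 := by omega
      simp only [this, hh, hd₂]; ring_nf
  have e2 : tollVar p m (n + 1) - tollVar p m n =
      2 * (binE p n (fun k => h k * g k) - binE p n h * binE p n g) +
      (p * binE p n (fun k => d₁ k ^ 2) + (1 - p) * binE p n (fun k => d₂ k ^ 2)) -
      binE p n g ^ 2 := by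
    have a1 := e1 (fun x => x ^ 2)
    have a2 := e1 (fun x => x)
    have a3 : tollVar p m n = binE p n (fun k => h k ^ 2) - binE p n h ^ 2 := rfl
    rw [a3, tollVar, a1, a2]
    have b1 : (fun k => (h k + d₁ k) ^ 2) = fun k => (h k ^ 2 + 2 * (h k * d₁ k)) + d₁ k ^ 2 := by
      ext k; ring
    have b2 : (fun k => (h k + d₂ k) ^ 2) = fun k => (h k ^ 2 + 2 * (h k * d₂ k)) + d₂ k ^ 2 := by
      ext k; ring
    have b3 : (fun k => h k * g k) = fun k => p * (h k * d₁ k) + (1 - p) * (h k * d₂ k) := by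
      ext k; simp only [hg]; ring
    rw [b1, b2, b3]
    simp only [hg, binE_add, binE_mul_left]
    ring
  obtain ⟨k₀, hk₀, c1, c2, c3⟩ := exists_center hp0 hp1 n
  have hΔ : ∀ k ≤ n, |m (k + 1) - m k| ≤ L * harm n := fun k hk =>
    (diff_le h0 h1 H k).trans (mul_le_mul_of_nonneg_left (harm_mono hk) hL)
  have hcast : ∀ k ≤ n, |((n - k : ℕ) : ℝ) - (n - k₀ : ℕ)| = |(k : ℝ) - k₀| := fun k hk => by
    rw [Nat.cast_sub hk, Nat.cast_sub hk₀, abs_sub_comm]; ring_nf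
  have hhA : ∀ k ≤ n, |h k - h k₀| ≤ 2 * (L * harm n) * |(k : ℝ) - k₀| := by
    intro k hk
    have a1 := sub_le_of_diff hΔ hk hk₀
    have a2 := sub_le_of_diff hΔ (Nat.sub_le n k) (Nat.sub_le n k₀)
    rw [hcast k hk] at a2
    have e : h k - h k₀ = (m k - m k₀) + (m (n - k) - m (n - k₀)) := by simp only [hh]; ring
    rw [e]
    exact (abs_add_le _ _).trans (by linarith)
  have hgB : ∀ k ≤ n, |g k - g k₀| ≤ 4 * (L * harm n) / n * |(k : ℝ) - k₀| := by
    intro k hk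
    have a1 := diff_sub_le_of_le hL H (k := k) hn hk₀
    have a2 := diff_sub_le_of_le hL H (k := n - k) hn (Nat.sub_le n k₀)
    rw [hcast k hk] at a2
    have e : g k - g k₀ = p * (d₁ k - d₁ k₀) + (1 - p) * (d₂ k - d₂ k₀) := by simp only [hg]; ring
    have b1 : p * (|(k : ℝ) - k₀| / ((k₀ : ℝ) + 1)) ≤ |(k : ℝ) - k₀| / n := by
      rw [mul_div_assoc', div_le_div_iff₀ (by positivity) (by positivity)]
      nlinarith [abs_nonneg ((k : ℝ) - k₀)]
    have b2 : (1 - p) * (|(k : ℝ) - k₀| / (((n - k₀ : ℕ) : ℝ) + 1)) ≤ |(k : ℝ) - k₀| / n := by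
      rw [mul_div_assoc', div_le_div_iff₀ (by positivity) (by positivity)]
      nlinarith [abs_nonneg ((k : ℝ) - k₀)]
    rw [e]
    refine (abs_add_le _ _).trans ?_
    rw [abs_mul, abs_mul, abs_of_pos hp0, abs_of_pos hq]
    have a3 := mul_le_mul_of_nonneg_left a1 hp0.le
    have a4 := mul_le_mul_of_nonneg_left a2 hq.le
    have b3 := mul_le_mul_of_nonneg_left b1 (mul_nonneg zero_le_two hK)
    have b4 := mul_le_mul_of_nonneg_left b2 (mul_nonneg zero_le_two hK)
    have b5 : 4 * (L * harm n) / n * |(k : ℝ) - k₀| = 2 * (2 * (L * harm n) * (|(k : ℝ) - k₀| / n)) := by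
      ring
    rw [b5]
    simp only [hd₁, hd₂]
    linarith
  have hcov := binE_cov_le hp0.le hp1.le (by positivity) (by positivity)
    (fun k : ℕ => abs_nonneg ((k : ℝ) - k₀)) hhA hgB
  have hsq := binE_sq_sub_center_le hp0 hp1 hn c3
  simp only [sq_abs] at hcov
  have hcov' : |binE p n (fun k => h k * g k) - binE p n h * binE p n g| ≤ 48 * (L * harm n) ^ 2 := by
    refine hcov.trans ((mul_le_mul_of_nonneg_left hsq (by positivity)).trans (le_of_eq ?_))
    field_simp; ring
  have hd1sq : ∀ k ≤ n, d₁ k ^ 2 ≤ (L * harm n) ^ 2 := fun k hk =>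
    sq_le_sq.2 ((hΔ k hk).trans (le_abs_self _))
  have hd2sq : ∀ k ≤ n, d₂ k ^ 2 ≤ (L * harm n) ^ 2 := fun k hk =>
    sq_le_sq.2 ((hΔ (n - k) (Nat.sub_le n k)).trans (le_abs_self _))
  have s1 := binE_mono hp0.le hp1.le hd1sq
  have s2 := binE_mono hp0.le hp1.le hd2sq
  have s1' := binE_nonneg hp0.le hp1.le (g := fun k => d₁ k ^ 2) (n := n) fun k _ => sq_nonneg _
  have s2' := binE_nonneg hp0.le hp1.le (g := fun k => d₂ k ^ 2) (n := n) fun k _ => sq_nonneg _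
  rw [binE_const] at s1 s2
  have s3 : binE p n g ^ 2 ≤ (L * harm n) ^ 2 := by
    refine sq_le_sq.2 ((abs_binE_le_of_le hp0.le hp1.le (h := fun _ => L * harm n)
      fun k hk => ?_).trans ?_)
    · refine (abs_add_le _ _).trans ?_
      rw [abs_mul, abs_mul, abs_of_pos hp0, abs_of_pos hq]
      have := hΔ k hk
      have := hΔ (n - k) (Nat.sub_le n k)
      simp only [hd₁, hd₂]
      nlinarith
    · rw [binE_const]; exact le_abs_self _
  have hc := abs_le.1 hcov'
  rw [e2, abs_le]
  constructor <;> nlinarith [sq_nonneg (binE p n g), mul_nonneg hp0.le s1', mul_nonneg hq.le s2',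
    mul_le_mul_of_nonneg_left s1 hp0.le, mul_le_mul_of_nonneg_left s2 hq.le]

lemma rpow_le_of_le {s x N : ℝ} (hs0 : 0 ≤ s) (hs1 : s ≤ 1) (hN : 0 < N) (hx : 0 ≤ x) :
    x ^ s ≤ N ^ s * (1 - s * (1 - x / N)) := by
  have h1 := rpow_one_add_le_one_add_mul_self (s := x / N - 1) (p := s)
    (by linarith [div_nonneg hx hN.le]) hs0 hs1
  rw [add_sub_cancel, Real.div_rpow hx hN.le, div_le_iff₀ (by positivity)] at h1
  linarith

lemma abs_var_succ_sub_le {p L : ℝ} (hp0 : 0 < p) (hp1 : p < 1) {m V : ℕ → ℝ} (hL : 0 ≤ L)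
    (h0 : m 0 = 0) (h1 : m 1 = 0)
    (H : ∀ n : ℕ, |m (n + 2) - 2 * m (n + 1) + m n| ≤ L / (n + 1))
    (hV0 : V 0 = 0) (hV1 : V 1 = 0)
    (hV : ∀ n, 2 ≤ n → V n = binE p n (fun k => V k + V (n - k)) + tollVar p m n) (n : ℕ) :
    |V (n + 1) - V n| ≤
      (40000 / (p * (1 - p)) * L ^ 2 + |V 2|) * ((n : ℝ) + 1) ^ (1 / 4 : ℝ) := by
  have hq : 0 < 1 - p := by linarith
  have hpq : 0 < p * (1 - p) := mul_pos hp0 hq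
  set D : ℕ → ℝ := fun n => V (n + 1) - V n with hD
  set K := 40000 / (p * (1 - p)) * L ^ 2 + |V 2| with hK
  have hK0 : 0 ≤ K := by positivity
  have hrec : ∀ n, 2 ≤ n → D n = binE p n (fun k => p * D k + (1 - p) * D (n - k)) +
      (tollVar p m (n + 1) - tollVar p m n) := by
    intro n hn
    have a1 := hV n hn
    have a2 := hV (n + 1) (by omega)
    rw [binE_add, binE_reflect p _ V] at a1 a2
    rw [binE_add, binE_mul_left, binE_mul_left, binE_reflect p n D]
    have a3 := binE_succ_sub p n V
    have a4 := binE_succ_sub (1 - p) n V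
    simp only [hD]
    linear_combination a2 - a1 + a3 + a4
  have hf : ∀ n, 2 ≤ n → binE p n (fun k => p * (K * ((k : ℝ) + 1) ^ (1 / 4 : ℝ)) +
      (1 - p) * (K * (((n - k : ℕ) : ℝ) + 1) ^ (1 / 4 : ℝ))) ≤
      (1 - p * (1 - p) / 4) * (K * ((n : ℝ) + 1) ^ (1 / 4 : ℝ)) := by
    intro n hn
    have hn' : (2 : ℝ) ≤ n := by exact_mod_cast hn
    have hone : ∀ r : ℝ, 0 < r → r < 1 → binE r n (fun k => K * ((k : ℝ) + 1) ^ (1 / 4 : ℝ)) ≤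
        (1 - (1 - r) / 8) * (K * ((n : ℝ) + 1) ^ (1 / 4 : ℝ)) := by
      intro r hr0 hr1
      have hP : 0 ≤ ((n : ℝ) + 1) ^ (1 / 4 : ℝ) := by positivity
      rw [binE_mul_left]
      calc _ ≤ K * binE r n (fun k => ((n : ℝ) + 1) ^ (1 / 4 : ℝ) *
            (((1 / 4) / (n + 1)) * k + (1 - 1 / 4 * (1 - 1 / (n + 1))))) := by
            refine mul_le_mul_of_nonneg_left (binE_mono hr0.le hr1.le fun k _ => ?_) hK0
            have := rpow_le_of_le (s := 1 / 4) (x := (k : ℝ) + 1) (N := (n : ℝ) + 1) (by norm_num)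
              (by norm_num) (by positivity) (by positivity)
            refine this.trans (le_of_eq ?_)
            congr 1; field_simp; ring
        _ = K * (((n : ℝ) + 1) ^ (1 / 4 : ℝ) *
            (((1 / 4) / (n + 1)) * (n * r) + (1 - 1 / 4 * (1 - 1 / (n + 1))))) := by
            rw [binE_mul_left, binE_add, binE_mul_left, binE_id, binE_const]
        _ ≤ K * (((n : ℝ) + 1) ^ (1 / 4 : ℝ) * (1 - (1 - r) / 8)) := by
            gcongr
            have : ((1 / 4) / ((n : ℝ) + 1)) * (n * r) + (1 - 1 / 4 * (1 - 1 / (n + 1))) =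
              1 - (1 - r) / 4 * (n / (n + 1)) := by field_simp; ring
            rw [this]
            have h2 : (1 / 2 : ℝ) ≤ n / (n + 1) := by
              rw [div_le_div_iff₀ (by positivity) (by positivity)]; linarith
            nlinarith
        _ = _ := by ring
    rw [binE_add, binE_mul_left p n p, binE_mul_left p n (1 - p),
      binE_reflect p n (fun k => K * ((k : ℝ) + 1) ^ (1 / 4 : ℝ))]
    have a1 := mul_le_mul_of_nonneg_left (hone p hp0 hp1) hp0.le
    have a2 := mul_le_mul_of_nonneg_left (hone (1 - p) hq (by linarith)) hq.le
    have : 0 ≤ K * ((n : ℝ) + 1) ^ (1 / 4 : ℝ) := by positivity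
    linarith
  have hε : ∀ n, 2 ≤ n → |tollVar p m (n + 1) - tollVar p m n| ≤
      p * (1 - p) / 4 * (K * ((n : ℝ) + 1) ^ (1 / 4 : ℝ)) := by
    intro n hn
    refine (abs_tollVar_succ_sub_le hp0 hp1 hL h0 h1 H (by omega)).trans ?_
    have a1 := harm_sq_le n
    have hP : 0 ≤ ((n : ℝ) + 1) ^ (1 / 4 : ℝ) := by positivity
    have a2 : 10000 * L ^ 2 ≤ p * (1 - p) / 4 * K := by
      have : p * (1 - p) / 4 * (40000 / (p * (1 - p)) * L ^ 2) = 10000 * L ^ 2 := by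
        field_simp; ring
      rw [hK, mul_add, this]
      linarith [show 0 ≤ p * (1 - p) / 4 * |V 2| by positivity]
    calc 98 * (L * harm n) ^ 2 = 98 * L ^ 2 * harm n ^ 2 := by ring
      _ ≤ 98 * L ^ 2 * (81 * ((n : ℝ) + 1) ^ (1 / 4 : ℝ)) := by gcongr
      _ ≤ (10000 * L ^ 2) * ((n : ℝ) + 1) ^ (1 / 4 : ℝ) := by
          nlinarith [mul_nonneg (sq_nonneg L) hP]
      _ ≤ (p * (1 - p) / 4 * K) * ((n : ℝ) + 1) ^ (1 / 4 : ℝ) := by gcongr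
      _ = _ := by ring
  have key : ∀ s : ℝ, |s| = 1 → ∀ n : ℕ, s * D n - K * ((n : ℝ) + 1) ^ (1 / 4 : ℝ) ≤ 0 := by
    intro s hs
    have hle : ∀ x, s * x ≤ |x| := fun x => by
      calc s * x ≤ |s * x| := le_abs_self _
        _ = |x| := by rw [abs_mul, hs, one_mul]
    refine binE_induction hp0 hp1 hp0.le hp1.le hq.le (by linarith)
      (D := fun n => s * D n - K * ((n : ℝ) + 1) ^ (1 / 4 : ℝ)) ?_ ?_ ?_
    · simp only [hD, hV0, hV1, zero_add]
      simp [hK0]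
    · have a1 := hle (D 1)
      simp only [hD, hV1] at a1 ⊢
      have a2 : (1 : ℝ) ≤ (((1 : ℕ) : ℝ) + 1) ^ (1 / 4 : ℝ) :=
        Real.one_le_rpow (by norm_num) (by norm_num)
      have a3 : |V 2| ≤ K := by rw [hK]; linarith [show 0 ≤ 40000 / (p * (1 - p)) * L ^ 2 by positivity]
      have a4 : K * 1 ≤ K * (((1 : ℕ) : ℝ) + 1) ^ (1 / 4 : ℝ) := by gcongr
      simp only [sub_zero, Nat.reduceAdd] at a1 ⊢
      linarith
    · intro n hn
      have a1 := hf n hn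
      have a2 := hle (tollVar p m (n + 1) - tollVar p m n)
      have a3 := hε n hn
      have h2 : (fun k : ℕ => p * (s * D k - K * ((k : ℝ) + 1) ^ (1 / 4 : ℝ)) +
          (1 - p) * (s * D (n - k) - K * (((n - k : ℕ) : ℝ) + 1) ^ (1 / 4 : ℝ))) = fun k : ℕ =>
          s * (p * D k + (1 - p) * D (n - k)) - (p * (K * ((k : ℝ) + 1) ^ (1 / 4 : ℝ)) +
          (1 - p) * (K * (((n - k : ℕ) : ℝ) + 1) ^ (1 / 4 : ℝ))) := by ext k; ring
      rw [h2, binE_sub, binE_mul_left]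
      rw [hrec n hn]
      linarith
  refine abs_le.2 ⟨?_, ?_⟩
  · linarith [key (-1) (by simp) n]
  · linarith [key 1 (by simp) n]

lemma norm_cexp_I_sub_one_le (y : ℝ) : ‖Complex.exp (Complex.I * y) - 1‖ ≤ |y| := by
  simpa using Real.norm_exp_I_mul_ofReal_sub_one_le (x := y)

lemma norm_cexp_I (y : ℝ) : ‖Complex.exp (Complex.I * y)‖ = 1 := by
  rw [mul_comm]; exact Complex.norm_exp_ofReal_mul_I y

lemma norm_cexp_I_sub_two_le (y : ℝ) :
    ‖Complex.exp (Complex.I * y) - 1 - Complex.I * y‖ ≤ 3 * |y| ^ 2 := by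
  have hn : ‖Complex.I * (y : ℂ)‖ = |y| := by simp
  rcases le_total |y| 1 with h | h
  · have := Complex.norm_exp_sub_one_sub_id_le (x := Complex.I * y) (by rw [hn]; exact h)
    rw [hn] at this
    nlinarith [sq_nonneg |y|]
  · have h1 := norm_cexp_I_sub_one_le y
    have h2 := norm_sub_le (Complex.exp (Complex.I * y) - 1) (Complex.I * y)
    rw [hn] at h2
    nlinarith

lemma norm_cexp_I_sub_three_le (y : ℝ) :
    ‖Complex.exp (Complex.I * y) - 1 - Complex.I * y + y ^ 2 / 2‖ ≤ 4 * |y| ^ 3 := by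
  have hn : ‖Complex.I * (y : ℂ)‖ = |y| := by simp
  rcases le_total |y| 1 with h | h
  · have := Complex.exp_bound (x := Complex.I * y) (by rw [hn]; exact h) (n := 3) (by norm_num)
    rw [hn] at this
    simp only [Finset.sum_range_succ, Finset.sum_range_zero, Nat.factorial] at this
    norm_num [mul_pow] at this
    have e : Complex.exp (Complex.I * y) - 1 - Complex.I * y + y ^ 2 / 2 =
      Complex.exp (Complex.I * y) - (1 + Complex.I * y + -(y : ℂ) ^ 2 / 2) := by ring
    rw [e]
    refine this.trans ?_
    nlinarith [pow_nonneg (abs_nonneg y) 3]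
  · have h1 := norm_cexp_I_sub_two_le y
    have h2 := norm_add_le (Complex.exp (Complex.I * y) - 1 - Complex.I * y) ((y : ℂ) ^ 2 / 2)
    have h3 : ‖(y : ℂ) ^ 2 / 2‖ = |y| ^ 2 / 2 := by simp
    rw [h3] at h2
    nlinarith [pow_nonneg (abs_nonneg y) 2, mul_le_mul_of_nonneg_left h (pow_nonneg (abs_nonneg y) 2)]

lemma abs_exp_neg_add_sub_le {a w : ℝ} (ha : 0 ≤ a) (haw : 0 ≤ a + w) :
    |Real.exp (-(a + w)) - Real.exp (-a) * (1 - w)| ≤ w ^ 2 := by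
  have e : Real.exp (-(a + w)) = Real.exp (-a) * Real.exp (-w) := by rw [← Real.exp_add]; ring_nf
  have h1 : Real.exp (-a) ≤ 1 := Real.exp_le_one_iff.2 (by linarith)
  have h2 : Real.exp (-(a + w)) ≤ 1 := Real.exp_le_one_iff.2 (by linarith)
  have h3 := Real.exp_pos (-a)
  have h4 := Real.add_one_le_exp (-w)
  rw [e, ← mul_sub, abs_mul, abs_of_pos h3, abs_of_nonneg (by linarith)]
  have h5 := Real.add_one_le_exp w
  have h6 : Real.exp (-w) * Real.exp w = 1 := by rw [← Real.exp_add]; simp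
  have h7 := Real.exp_pos (-w)
  have h8 : Real.exp (-w) * (1 + w) ≤ 1 := by nlinarith
  rcases le_total 0 w with hw | hw
  · have h9 : Real.exp (-w) - (1 - w) ≤ w ^ 2 := by
      rcases le_total w 1 with h | h
      · have : Real.exp (-w) * (1 + w) ≤ (1 - w + w ^ 2) * (1 + w) := by
          nlinarith [pow_nonneg hw 3]
        have := le_of_mul_le_mul_right this (by linarith)
        linarith
      · have : Real.exp (-w) ≤ 1 := Real.exp_le_one_iff.2 (by linarith)
        nlinarith
    nlinarith [sq_nonneg w]
  · have h9 : Real.exp (-w) - (1 - w) ≤ w ^ 2 * Real.exp (-w) := by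
      nlinarith [mul_le_mul_of_nonneg_right h8 (by linarith : (0:ℝ) ≤ 1 - w)]
    calc _ ≤ Real.exp (-a) * (w ^ 2 * Real.exp (-w)) := by gcongr
      _ = w ^ 2 * Real.exp (-(a + w)) := by rw [e]; ring
      _ ≤ w ^ 2 * 1 := by gcongr
      _ = w ^ 2 := mul_one _

lemma norm_pow_sub_pow_le_of_norm_le_one {a b : ℂ} (ha : ‖a‖ ≤ 1) (hb : ‖b‖ ≤ 1) (n : ℕ) :
    ‖a ^ n - b ^ n‖ ≤ n * ‖a - b‖ := by
  induction n with
  | zero => simp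
  | succ n ih =>
    have e : a ^ (n + 1) - b ^ (n + 1) = a ^ n * (a - b) + (a ^ n - b ^ n) * b := by ring
    rw [e]
    refine (norm_add_le _ _).trans ?_
    rw [norm_mul, norm_mul, norm_pow]
    have h1 : ‖a‖ ^ n ≤ 1 := pow_le_one₀ (norm_nonneg _) ha
    push_cast
    nlinarith [norm_nonneg (a - b), norm_nonneg (a ^ n - b ^ n)]

lemma norm_binE_cexp_sub_le {p : ℝ} (hp0 : 0 ≤ p) (hp1 : p ≤ 1) (n : ℕ) (l : ℝ) :
    ‖binE p n (fun k => Complex.exp (Complex.I * (l * ((k : ℝ) - n * p) : ℝ))) -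
      (Real.exp (-(l ^ 2 * (n * p * (1 - p)) / 2)) : ℝ)‖ ≤ n * (4 * |l| ^ 3 + |l| ^ 4) := by
  have hq0 : 0 ≤ 1 - p := by linarith
  have e1 : binE p n (fun k => Complex.exp (Complex.I * (l * ((k : ℝ) - n * p) : ℝ))) =
      (p * Complex.exp (Complex.I * (l * (1 - p) : ℝ)) +
        (1 - p) * Complex.exp (Complex.I * (-(l * p) : ℝ))) ^ n := by
    have := binE_cexp p n (Complex.I * l)
    push_cast
    have e2 : ∀ k : ℕ, Complex.I * (l * ((k : ℂ) - n * p)) = Complex.I * l * ((k : ℂ) - n * p) :=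
      fun k => by ring
    simp only [e2, this]
    congr 3 <;> ring_nf
  have e3 : (Real.exp (-(l ^ 2 * (n * p * (1 - p)) / 2)) : ℂ) =
      ((Real.exp (-(l ^ 2 * (p * (1 - p)) / 2)) : ℝ) : ℂ) ^ n := by
    rw [← Complex.ofReal_pow, ← Real.exp_nat_mul]; congr 2; ring
  rw [e1, e3]
  have hpq : p * (1 - p) ≤ 1 := by nlinarith
  have hpq0 : 0 ≤ p * (1 - p) := by positivity
  refine (norm_pow_sub_pow_le_of_norm_le_one ?_ ?_ n).trans ?_
  · refine (norm_add_le _ _).trans ?_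
    rw [norm_mul, norm_mul, norm_cexp_I, norm_cexp_I]
    have h1 : ‖(p : ℂ)‖ = p := by simp [abs_of_nonneg hp0]
    have h2 : ‖(1 - p : ℂ)‖ = 1 - p := by
      rw [← Complex.ofReal_one, ← Complex.ofReal_sub, Complex.norm_real, Real.norm_of_nonneg hq0]
    rw [h1, h2]; linarith
  · rw [Complex.norm_real, Real.norm_of_nonneg (Real.exp_pos _).le, Real.exp_le_one_iff]
    have : 0 ≤ l ^ 2 * (p * (1 - p)) := by positivity
    linarith
  gcongr
  set y₁ := l * (1 - p)
  set y₂ := -(l * p)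
  have h1 := norm_cexp_I_sub_three_le y₁
  have h2 := norm_cexp_I_sub_three_le y₂
  have h3 := abs_exp_neg_add_sub_le (a := 0) (w := l ^ 2 * (p * (1 - p)) / 2) le_rfl
    (by positivity)
  have b1 : |y₁| ≤ |l| := by
    rw [abs_mul, abs_of_nonneg hq0]; nlinarith [abs_nonneg l]
  have b2 : |y₂| ≤ |l| := by
    rw [abs_neg, abs_mul, abs_of_nonneg hp0]; nlinarith [abs_nonneg l]
  have b3 : (l ^ 2 * (p * (1 - p)) / 2) ^ 2 ≤ |l| ^ 4 := by
    have : (p * (1 - p)) ^ 2 ≤ 1 := pow_le_one₀ hpq0 hpq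
    rw [show |l| ^ 4 = l ^ 4 by rw [← abs_pow, abs_of_nonneg (by positivity)]]
    nlinarith [show 0 ≤ l ^ 4 by positivity]
  simp only [zero_add, neg_zero, Real.exp_zero, one_mul] at h3
  have e4 : (p : ℂ) * Complex.exp (Complex.I * (y₁ : ℝ)) +
        (1 - p) * Complex.exp (Complex.I * (y₂ : ℝ)) -
        (Real.exp (-(l ^ 2 * (p * (1 - p)) / 2)) : ℝ) =
      (p : ℂ) * (Complex.exp (Complex.I * y₁) - 1 - Complex.I * y₁ + y₁ ^ 2 / 2) +
      ((1 - p : ℝ) : ℂ) * (Complex.exp (Complex.I * y₂) - 1 - Complex.I * y₂ + y₂ ^ 2 / 2) -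
      ((Real.exp (-(l ^ 2 * (p * (1 - p)) / 2)) - (1 - l ^ 2 * (p * (1 - p)) / 2) : ℝ) : ℂ) := by
    simp only [y₁, y₂]; push_cast; ring
  rw [e4]
  refine (norm_sub_le _ _).trans (add_le_add ((norm_add_le _ _).trans ?_) ?_)
  · rw [norm_mul, norm_mul, Complex.norm_real, Complex.norm_real, Real.norm_of_nonneg hp0,
      Real.norm_of_nonneg hq0]
    calc _ ≤ p * (4 * |l| ^ 3) + (1 - p) * (4 * |l| ^ 3) := by
          gcongr
          · exact h1.trans (by gcongr)
          · exact h2.trans (by gcongr)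
      _ = _ := by ring
  · rw [Complex.norm_real, Real.norm_eq_abs]
    exact h3.trans b3

lemma norm_cexp_add_sub_le (y r : ℝ) :
    ‖Complex.exp (Complex.I * (y + r : ℝ)) -
      (Complex.exp (Complex.I * y) + Complex.I * r - ((r * y + r ^ 2 / 2 : ℝ) : ℂ))‖ ≤
      4 * |r| ^ 3 + 3 * (|r| * |y| ^ 2) + |r| ^ 2 * |y| := by
  have e : Complex.exp (Complex.I * (y + r : ℝ)) -
      (Complex.exp (Complex.I * y) + Complex.I * r - ((r * y + r ^ 2 / 2 : ℝ) : ℂ)) =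
      Complex.exp (Complex.I * y) *
        (Complex.exp (Complex.I * r) - 1 - Complex.I * r + r ^ 2 / 2) +
      (Complex.I * r) * (Complex.exp (Complex.I * y) - 1 - Complex.I * y) -
      (r ^ 2 / 2 : ℝ) * (Complex.exp (Complex.I * y) - 1) := by
    push_cast
    rw [mul_add, Complex.exp_add]
    linear_combination ((r : ℂ) * y) * Complex.I_mul_I
  rw [e]
  have hr : ‖Complex.I * (r : ℂ)‖ = |r| := by simp
  refine (norm_sub_le _ _).trans (add_le_add ((norm_add_le _ _).trans (add_le_add ?_ ?_)) ?_)
  · rw [norm_mul, norm_cexp_I, one_mul]; exact norm_cexp_I_sub_three_le r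
  · rw [norm_mul, hr]
    nlinarith [norm_cexp_I_sub_two_le y, abs_nonneg r]
  · rw [norm_mul, Complex.norm_real, Real.norm_of_nonneg (by positivity), ← sq_abs]
    have := norm_cexp_I_sub_one_le y
    have h2 : |r| ^ 2 / 2 ≤ |r| ^ 2 := by linarith [sq_nonneg |r|]
    exact mul_le_mul h2 this (norm_nonneg _) (sq_nonneg _)

set_option maxHeartbeats 1000000 in
lemma norm_binE_gaussian_step_le {p c L h l a : ℝ} (hp0 : 0 ≤ p) (hp1 : p ≤ 1) {n : ℕ}
    (hc : 1 ≤ c) (hL : 0 ≤ L) (hh : 1 ≤ h) (hn : (n : ℝ) = h ^ 4) (hLh : L * h ^ 2 ≤ c)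
    (hl : |l| ≤ c * L) (ha : 0 ≤ a) {r w u : ℕ → ℝ} (hu1 : ∀ k ≤ n, 1 ≤ u k)
    (hx : ∀ k ≤ n, |(k : ℝ) - n * p| ≤ h ^ 2 * u k)
    (hr : ∀ k ≤ n, |r k| ≤ c * L * u k) (hw : ∀ k ≤ n, |w k| ≤ c * L ^ 2 * h ^ 3 * u k)
    (haw : ∀ k ≤ n, 0 ≤ a + w k) (hr0 : binE p n r = 0) (hw0 : binE p n w = 0)
    (hu : binE p n (fun k => u k ^ 3) ≤ c) :
    ‖binE p n (fun k => (Real.exp (-(a + w k)) : ℂ) *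
        Complex.exp (Complex.I * (l * ((k : ℝ) - n * p) + r k : ℝ))) -
      (Real.exp (-(a + binE p n (fun k => (l * ((k : ℝ) - n * p) + r k) ^ 2) / 2)) : ℝ)‖ ≤
      22 * c ^ 7 * (L ^ 3 * h ^ 5) := by
  have hc0 : 0 ≤ c := by linarith
  have hh0 : 0 ≤ h := by linarith
  have hq0 : 0 ≤ 1 - p := by linarith
  have hLc : L ≤ c := le_trans (by nlinarith [one_le_pow₀ hh (n := 2)]) hLh
  set x : ℕ → ℝ := fun k => (k : ℝ) - n * p with hxdef
  have hu0 : ∀ k ≤ n, 0 ≤ u k := fun k hk => by linarith [hu1 k hk]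
  have hy : ∀ k ≤ n, |l * x k| ≤ c * L * h ^ 2 * u k := fun k hk => by
    rw [abs_mul]
    calc |l| * |x k| ≤ (c * L) * (h ^ 2 * u k) :=
          mul_le_mul hl (hx k hk) (abs_nonneg _) (by positivity)
      _ = _ := by ring
  have hpw : ∀ {m j : ℕ}, m ≤ j → h ^ m ≤ h ^ j := fun hmj => pow_le_pow_right₀ hh hmj
  have hpc : ∀ {m j : ℕ}, m ≤ j → c ^ m ≤ c ^ j := fun hmj => pow_le_pow_right₀ hc hmj
  have hu23 : ∀ k ≤ n, u k ^ 2 ≤ u k ^ 3 := fun k hk => pow_le_pow_right₀ (hu1 k hk) (by norm_num)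
  set Z := L ^ 3 * h ^ 5 with hZ
  have hZ0 : 0 ≤ Z := by positivity
  -- removing the fluctuation of the exponent
  have s1 : ‖binE p n (fun k => (Real.exp (-(a + w k)) : ℂ) *
        Complex.exp (Complex.I * (l * x k + r k : ℝ))) -
      Real.exp (-a) * binE p n (fun k => Complex.exp (Complex.I * (l * x k + r k : ℝ)))‖ ≤
      3 * c ^ 4 * Z := by
    have e : binE p n (fun k => (Real.exp (-(a + w k)) : ℂ) *
          Complex.exp (Complex.I * (l * x k + r k : ℝ))) -
        Real.exp (-a) * binE p n (fun k => Complex.exp (Complex.I * (l * x k + r k : ℝ))) =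
        binE p n (fun k => (((Real.exp (-(a + w k)) : ℂ) *
          Complex.exp (Complex.I * (l * x k + r k : ℝ))) -
          Real.exp (-a) * Complex.exp (Complex.I * (l * x k + r k : ℝ))) +
          Real.exp (-a) * (w k : ℂ)) := by
      rw [binE_add, binE_sub, binE_mul_left_complex, binE_mul_left_complex, binE_ofReal, hw0]
      simp
    rw [e]
    calc _ ≤ binE p n (fun k => (3 * c ^ 3 * Z) * u k ^ 3) := by
          refine norm_binE_le_of_le hp0 hp1 fun k hk => ?_
          set t := l * x k + r k with ht
          have e2 : ((Real.exp (-(a + w k)) : ℂ) * Complex.exp (Complex.I * (t : ℝ))) -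
              Real.exp (-a) * Complex.exp (Complex.I * (t : ℝ)) + Real.exp (-a) * (w k : ℂ) =
              ((Real.exp (-(a + w k)) - Real.exp (-a) * (1 - w k) : ℝ) : ℂ) *
                Complex.exp (Complex.I * t) -
              ((Real.exp (-a) * w k : ℝ) : ℂ) * (Complex.exp (Complex.I * t) - 1) := by
            push_cast; ring
          rw [e2]
          have ht' : |t| ≤ 2 * (c * L * h ^ 2 * u k) := by
            refine (abs_add_le _ _).trans ?_
            have := hr k hk
            have h2 : c * L * u k ≤ c * L * h ^ 2 * u k := by
              have := hu0 k hk
              calc c * L * u k = c * L * 1 * u k := by ring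
                _ ≤ _ := by gcongr; exact one_le_pow₀ hh
            linarith [hy k hk]
          have hwk := hw k hk
          have b1 : w k ^ 2 ≤ c ^ 3 * Z * u k ^ 2 := by
            calc w k ^ 2 = |w k| ^ 2 := (sq_abs _).symm
              _ ≤ (c * L ^ 2 * h ^ 3 * u k) ^ 2 := by gcongr
              _ = c ^ 2 * L ^ 3 * h ^ 4 * u k ^ 2 * (L * h ^ 2) := by ring
              _ ≤ c ^ 2 * L ^ 3 * h ^ 5 * u k ^ 2 * c := by
                  gcongr
                  norm_num
              _ = _ := by rw [hZ]; ring
          have b2 : |w k| * |t| ≤ 2 * c ^ 2 * Z * u k ^ 2 := by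
            calc |w k| * |t| ≤ (c * L ^ 2 * h ^ 3 * u k) * (2 * (c * L * h ^ 2 * u k)) := by
                  have := hu0 k hk
                  gcongr
              _ = _ := by rw [hZ]; ring
          have hea : Real.exp (-a) ≤ 1 := Real.exp_le_one_iff.2 (by linarith)
          refine (norm_sub_le _ _).trans ?_
          rw [norm_mul, norm_cexp_I, mul_one, norm_mul, Complex.norm_real, Complex.norm_real,
            Real.norm_eq_abs, Real.norm_eq_abs, abs_mul, abs_of_pos (Real.exp_pos _)]
          have b3 : Real.exp (-a) * |w k| * ‖Complex.exp (Complex.I * t) - 1‖ ≤ |w k| * |t| := by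
            have := norm_cexp_I_sub_one_le t
            calc _ ≤ 1 * |w k| * |t| := by gcongr
              _ = _ := by ring
          have b4 := abs_exp_neg_add_sub_le ha (haw k hk)
          have b5 : c ^ 2 ≤ c ^ 3 := hpc (by norm_num)
          calc _ ≤ c ^ 3 * Z * u k ^ 2 + 2 * c ^ 2 * Z * u k ^ 2 := by linarith
            _ ≤ c ^ 3 * Z * u k ^ 3 + 2 * c ^ 3 * Z * u k ^ 3 := by
                have := hu23 k hk
                have := hu0 k hk
                gcongr
            _ = _ := by ring
      _ = (3 * c ^ 3 * Z) * binE p n (fun k => u k ^ 3) := binE_mul_left _ _ _ _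
      _ ≤ (3 * c ^ 3 * Z) * c := by gcongr
      _ = _ := by ring
  -- linearising the toll
  set B := binE p n (fun k => r k * (l * x k) + r k ^ 2 / 2) with hB
  set A := l ^ 2 * (n * p * (1 - p)) / 2 with hA
  have hA0 : 0 ≤ A := by positivity
  have s2 : ‖binE p n (fun k => Complex.exp (Complex.I * (l * x k + r k : ℝ))) -
      (binE p n (fun k => Complex.exp (Complex.I * (l * x k : ℝ))) - B)‖ ≤ 8 * c ^ 4 * Z := by
    have e : binE p n (fun k => Complex.exp (Complex.I * (l * x k + r k : ℝ))) -
        (binE p n (fun k => Complex.exp (Complex.I * (l * x k : ℝ))) - B) =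
        binE p n (fun k => Complex.exp (Complex.I * (l * x k + r k : ℝ)) -
          (Complex.exp (Complex.I * (l * x k : ℝ)) + Complex.I * r k -
            ((r k * (l * x k) + r k ^ 2 / 2 : ℝ) : ℂ))) := by
      rw [binE_sub, binE_sub, binE_add, binE_mul_left_complex, binE_ofReal, binE_ofReal, hr0, hB]
      simp
    rw [e]
    calc _ ≤ binE p n (fun k => (8 * c ^ 3 * Z) * u k ^ 3) := by
          refine norm_binE_le_of_le hp0 hp1 fun k hk => ?_
          refine (norm_cexp_add_sub_le _ _).trans ?_
          have hrk := hr k hk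
          have hyk := hy k hk
          have hu0k := hu0 k hk
          have t1 : |r k| ^ 3 ≤ (c ^ 3 * Z) * u k ^ 3 := by
            calc |r k| ^ 3 ≤ (c * L * u k) ^ 3 := by gcongr
              _ = c ^ 3 * (L ^ 3 * 1) * u k ^ 3 := by ring
              _ ≤ _ := by rw [hZ]; gcongr; exact one_le_pow₀ hh
          have t2 : |r k| * |l * x k| ^ 2 ≤ (c ^ 3 * Z) * u k ^ 3 := by
            calc |r k| * |l * x k| ^ 2 ≤ (c * L * u k) * (c * L * h ^ 2 * u k) ^ 2 := by gcongr
              _ = c ^ 3 * (L ^ 3 * h ^ 4) * u k ^ 3 := by ring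
              _ ≤ _ := by rw [hZ]; gcongr; norm_num
          have t3 : |r k| ^ 2 * |l * x k| ≤ (c ^ 3 * Z) * u k ^ 3 := by
            calc |r k| ^ 2 * |l * x k| ≤ (c * L * u k) ^ 2 * (c * L * h ^ 2 * u k) := by gcongr
              _ = c ^ 3 * (L ^ 3 * h ^ 2) * u k ^ 3 := by ring
              _ ≤ _ := by rw [hZ]; gcongr; norm_num
          linarith
      _ = (8 * c ^ 3 * Z) * binE p n (fun k => u k ^ 3) := binE_mul_left _ _ _ _
      _ ≤ (8 * c ^ 3 * Z) * c := by gcongr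
      _ = _ := by ring
  -- the linear part
  have s3 : ‖binE p n (fun k => Complex.exp (Complex.I * (l * x k : ℝ))) -
      (Real.exp (-A) : ℝ)‖ ≤ 5 * c ^ 5 * Z := by
    refine (norm_binE_cexp_sub_le hp0 hp1 n l).trans ?_
    rw [hn]
    have t1 : |l| ^ 3 ≤ (c * L) ^ 3 := by gcongr
    have t2 : |l| ^ 4 ≤ (c * L) ^ 4 := by gcongr
    have t4 : c ^ 3 ≤ c ^ 4 := hpc (by norm_num)
    calc h ^ 4 * (4 * |l| ^ 3 + |l| ^ 4) ≤ h ^ 4 * (4 * (c * L) ^ 3 + (c * L) ^ 4) := by gcongr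
      _ = 4 * c ^ 3 * (L ^ 3 * h ^ 4) + c ^ 4 * (L ^ 3 * (L * h ^ 4)) := by ring
      _ ≤ 4 * c ^ 5 * (L ^ 3 * h ^ 5) + c ^ 4 * (L ^ 3 * (c * h ^ 5)) := by
          have := hpc (m := 3) (j := 5) (by norm_num)
          have := hpw (m := 4) (j := 5) (by norm_num)
          gcongr
      _ = _ := by rw [hZ]; ring
  have hEu2 : binE p n (fun k => u k ^ 2) ≤ c := (binE_mono hp0 hp1 hu23).trans hu
  have hBb : |B| ≤ 2 * c ^ 3 * (L ^ 2 * h ^ 2) := by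
    calc |B| ≤ binE p n (fun k => (2 * c ^ 2 * (L ^ 2 * h ^ 2)) * u k ^ 2) := by
          refine abs_binE_le_of_le hp0 hp1 fun k hk => ?_
          have hrk := hr k hk
          have hyk := hy k hk
          have hu0k := hu0 k hk
          have t1 : |r k * (l * x k)| ≤ (c * L * u k) * (c * L * h ^ 2 * u k) := by
            rw [abs_mul]; gcongr
          have t2 : |r k ^ 2 / 2| ≤ (c * L * u k) ^ 2 * h ^ 2 := by
            rw [abs_of_nonneg (by positivity), ← sq_abs]
            have : |r k| ^ 2 ≤ (c * L * u k) ^ 2 := by gcongr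
            nlinarith [one_le_pow₀ hh (n := 2), sq_nonneg (c * L * u k)]
          refine (abs_add_le _ _).trans ?_
          linarith
      _ = (2 * c ^ 2 * (L ^ 2 * h ^ 2)) * binE p n (fun k => u k ^ 2) := binE_mul_left _ _ _ _
      _ ≤ (2 * c ^ 2 * (L ^ 2 * h ^ 2)) * c := by gcongr
      _ = _ := by ring
  have hAb : A ≤ c ^ 2 * L ^ 2 * h ^ 4 := by
    have t1 : l ^ 2 ≤ (c * L) ^ 2 := by rw [← sq_abs]; gcongr
    have t2 : p * (1 - p) ≤ 1 := by nlinarith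
    have t3 : 0 ≤ p * (1 - p) := by positivity
    calc A = l ^ 2 * (h ^ 4 * (p * (1 - p))) / 2 := by rw [hA, hn]; ring
      _ ≤ (c * L) ^ 2 * (h ^ 4 * 1) / 2 := by gcongr
      _ ≤ _ := by
        have : 0 ≤ (c * L) ^ 2 * h ^ 4 := by positivity
        linarith
  have hAB : A + B = binE p n (fun k => (l * x k + r k) ^ 2) / 2 := by
    have : (fun k => (l * x k + r k) ^ 2) =
        fun k => l ^ 2 * (x k) ^ 2 + 2 * (r k * (l * x k) + r k ^ 2 / 2) := by ext k; ring
    rw [this, binE_add, binE_mul_left, binE_mul_left, binE_centered_sq]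
    ring
  have hAB0 : 0 ≤ A + B := by
    rw [hAB]; exact div_nonneg (binE_nonneg hp0 hp1 fun k _ => sq_nonneg _) two_pos.le
  have s4 : |Real.exp (-(A + B)) - (Real.exp (-A) - B)| ≤ 6 * c ^ 7 * Z := by
    have t1 := abs_exp_neg_add_sub_le hA0 hAB0
    have t2 : |B * (1 - Real.exp (-A))| ≤ |B| * A := by
      rw [abs_mul]
      gcongr
      rw [abs_of_nonneg]
      · linarith [Real.add_one_le_exp (-A)]
      · linarith [Real.exp_le_one_iff.2 (neg_nonpos.2 hA0)]
    have e : Real.exp (-(A + B)) - (Real.exp (-A) - B) =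
      (Real.exp (-(A + B)) - Real.exp (-A) * (1 - B)) + B * (1 - Real.exp (-A)) := by ring
    rw [e]
    refine (abs_add_le _ _).trans ((add_le_add t1 t2).trans ?_)
    rw [← sq_abs]
    calc |B| ^ 2 + |B| * A ≤ (2 * c ^ 3 * (L ^ 2 * h ^ 2)) ^ 2 +
          (2 * c ^ 3 * (L ^ 2 * h ^ 2)) * (c ^ 2 * L ^ 2 * h ^ 4) := by gcongr
      _ = 4 * c ^ 6 * (L ^ 3 * h ^ 2) * (L * h ^ 2) +
          2 * c ^ 5 * (L ^ 3 * h ^ 4) * (L * h ^ 2) := by ring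
      _ ≤ 4 * c ^ 6 * (L ^ 3 * h ^ 5) * c + 2 * c ^ 6 * (L ^ 3 * h ^ 5) * c := by
          have := hpw (m := 4) (j := 5) (by norm_num)
          have := hpw (m := 2) (j := 5) (by norm_num)
          have := hpc (m := 5) (j := 6) (by norm_num)
          gcongr
      _ = _ := by rw [hZ]; ring
  rw [← hAB]
  have e5 : (Real.exp (-(a + (A + B))) : ℂ) = Real.exp (-a) * Real.exp (-(A + B)) := by
    rw [← Complex.ofReal_mul, ← Real.exp_add]; congr 2; ring
  rw [e5]
  set X := binE p n (fun k => (Real.exp (-(a + w k)) : ℂ) *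
        Complex.exp (Complex.I * (l * x k + r k : ℝ)))
  set Y := binE p n (fun k => Complex.exp (Complex.I * (l * x k + r k : ℝ)))
  set W := binE p n (fun k => Complex.exp (Complex.I * (l * x k : ℝ)))
  have e6 : X - Real.exp (-a) * Real.exp (-(A + B)) =
      (X - Real.exp (-a) * Y) + Real.exp (-a) * ((Y - (W - B)) + (W - (Real.exp (-A) : ℝ)) -
        ((Real.exp (-(A + B)) - (Real.exp (-A) - B) : ℝ) : ℂ)) := by
    push_cast; ring
  rw [e6]
  have hea : Real.exp (-a) ≤ 1 := Real.exp_le_one_iff.2 (by linarith)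
  have s5 : ‖(Y - (W - B)) + (W - (Real.exp (-A) : ℝ)) -
        ((Real.exp (-(A + B)) - (Real.exp (-A) - B) : ℝ) : ℂ)‖ ≤
        8 * c ^ 4 * Z + 5 * c ^ 5 * Z + 6 * c ^ 7 * Z := by
    refine (norm_sub_le _ _).trans (add_le_add ((norm_add_le _ _).trans (add_le_add s2 s3)) ?_)
    rw [Complex.norm_real]; exact s4
  refine (norm_add_le _ _).trans ?_
  rw [norm_mul, Complex.norm_real, Real.norm_of_nonneg (Real.exp_pos _).le]
  have s6 := mul_le_mul hea s5 (norm_nonneg _) zero_le_one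
  have s7 : c ^ 4 * Z ≤ c ^ 7 * Z := by gcongr 1; exact hpc (by norm_num)
  have s8 : c ^ 5 * Z ≤ c ^ 7 * Z := by gcongr 1; exact hpc (by norm_num)
  linarith

lemma tollVar_eq (p : ℝ) (m : ℕ → ℝ) (n : ℕ) : tollVar p m n =
    binE p n (fun k => (m k + m (n - k) - binE p n (fun k => m k + m (n - k))) ^ 2) := by
  rw [tollVar]
  generalize ht : (fun k => m k + m (n - k)) = t
  have ht' : ∀ k, m k + m (n - k) = t k := fun k => by rw [← ht]
  simp only [ht']
  have : (fun k => (t k - binE p n t) ^ 2) =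
      fun k => (t k ^ 2 - 2 * binE p n t * t k) + binE p n t ^ 2 := by ext k; ring
  rw [this, binE_add, binE_sub, binE_mul_left, binE_const]
  ring

lemma binE_binDev_le {p : ℝ} {n : ℕ} (hn : 1 ≤ n) (hp0 : 0 < p) (hp1 : p < 1) :
    binE p n (binDev p n) ≤ 2 := by
  have hn' : (0 : ℝ) < n := by exact_mod_cast hn
  have e : binDev p n = fun k : ℕ => 1 + (1 / n) * ((k : ℝ) - n * p) ^ 2 := by
    ext k; rw [binDev]; ring
  rw [e, binE_add, binE_const, binE_mul_left, binE_centered_sq]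
  have : 1 / (n : ℝ) * (n * p * (1 - p)) = p * (1 - p) := by field_simp
  rw [this]; nlinarith

lemma abs_sub_binE_le {p : ℝ} {n : ℕ} (hn : 1 ≤ n) (hp0 : 0 < p) (hp1 : p < 1) {g : ℕ → ℝ}
    {a b : ℝ} (hb : 0 ≤ b) (H : ∀ k ≤ n, |g k - a| ≤ b * binDev p n k) :
    ∀ k ≤ n, |g k - binE p n g| ≤ 3 * b * binDev p n k := by
  intro k hk
  have h1 : |binE p n g - a| ≤ b * 2 := by
    have e : binE p n g - a = binE p n (fun k => g k - a) := by rw [binE_sub, binE_const]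
    rw [e]
    refine (abs_binE_le_of_le hp0.le hp1.le H).trans ?_
    rw [binE_mul_left]
    gcongr
    exact binE_binDev_le hn hp0 hp1
  have h2 := H k hk
  have e : g k - binE p n g = (g k - a) - (binE p n g - a) := by ring
  rw [e]
  refine (abs_sub _ _).trans ?_
  nlinarith [one_le_binDev p n k]

lemma abs_diff_sub_diff_le {p L : ℝ} (hp0 : 0 < p) (hp1 : p < 1) {m : ℕ → ℝ} (hL : 0 ≤ L)
    (H : ∀ n : ℕ, |m (n + 2) - 2 * m (n + 1) + m n| ≤ L / (n + 1)) {n i j : ℕ} (hn : 1 ≤ n)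
    (hij : i ≤ j) (hj : j ≤ n) (hi : n * (p * (1 - p)) ≤ (i : ℝ) + 1) :
    |(m (j + 1) - m j) - (m (i + 1) - m i)| ≤ L / (p * (1 - p)) := by
  obtain ⟨x, rfl⟩ := Nat.exists_eq_add_of_le hij
  have hn' : (0 : ℝ) < n := by exact_mod_cast hn
  have hpq : 0 < p * (1 - p) := mul_pos hp0 (by linarith)
  refine (diff_sub_le H i x).trans ?_
  rw [div_eq_mul_one_div]
  gcongr
  refine (harm_add_sub_le i x).trans ?_
  have hx : (x : ℝ) ≤ n := by exact_mod_cast (by omega : x ≤ n)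
  calc (x : ℝ) / (i + 1) ≤ n / (n * (p * (1 - p))) := by gcongr
    _ = _ := by field_simp

set_option maxHeartbeats 1000000 in
lemma exists_norm_binE_step_le {p A M : ℝ} (hp0 : 0 < p) (hp1 : p < 1) (hA : 0 ≤ A) (hM : 0 ≤ M) :
    ∃ C, 0 ≤ C ∧ ∀ (L : ℝ) (m V : ℕ → ℝ), 0 ≤ L →
      (∀ n : ℕ, |m (n + 2) - 2 * m (n + 1) + m n| ≤ L / (n + 1)) →
      (∀ n : ℕ, |V (n + 1) - V n| ≤ A * L ^ 2 * ((n : ℝ) + 1) ^ (1 / 4 : ℝ)) →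
      (∀ n, 0 ≤ V n) → ∀ n : ℕ, 1 ≤ n → L ^ 2 * n ≤ M →
      V n = binE p n (fun k => V k + V (n - k)) + tollVar p m n →
      ‖binE p n (fun k => (Real.exp (-(V k / 2)) : ℂ) * Real.exp (-(V (n - k) / 2)) *
          Complex.exp (Complex.I * (m k + m (n - k) - binE p n (fun k => m k + m (n - k)) : ℝ))) -
        (Real.exp (-(V n / 2)) : ℝ)‖ ≤ C * (L ^ 3 * (n : ℝ) ^ (5 / 4 : ℝ)) := by
  have hpq : 0 < p * (1 - p) := mul_pos hp0 (by linarith)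
  set c : ℝ := 6000 * Real.exp 1 + 12 / (p * (1 - p)) + 12 * A + M + 1 with hc
  have hcA : 12 * A ≤ c := by
    rw [hc]; linarith [Real.exp_pos 1, show 0 < 12 / (p * (1 - p)) by positivity]
  have hcp : 12 / (p * (1 - p)) ≤ c := by rw [hc]; linarith [Real.exp_pos 1]
  have hcM : M + 1 ≤ c := by
    rw [hc]; linarith [Real.exp_pos 1, show 0 < 12 / (p * (1 - p)) by positivity]
  have hce : 6000 * Real.exp 1 ≤ c := by
    rw [hc]; linarith [show 0 < 12 / (p * (1 - p)) by positivity]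
  clear_value c
  have hc1 : 1 ≤ c := by linarith
  refine ⟨22 * c ^ 7, by positivity, ?_⟩
  intro L m V hL H hΔ hV0 n hn hLn hV
  have hn' : (1 : ℝ) ≤ n := by exact_mod_cast hn
  have hnpos : (0 : ℝ) < n := by linarith
  set h : ℝ := (n : ℝ) ^ (1 / 4 : ℝ) with hh
  have hh1 : 1 ≤ h := Real.one_le_rpow hn' (by norm_num)
  have hh4 : (n : ℝ) = h ^ 4 := by
    rw [hh, ← Real.rpow_natCast, ← Real.rpow_mul hnpos.le]; norm_num
  have hh5 : (n : ℝ) ^ (5 / 4 : ℝ) = h ^ 5 := by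
    rw [hh, ← Real.rpow_natCast, ← Real.rpow_mul hnpos.le]; norm_num
  have hh0 : 0 ≤ h := by linarith
  rw [hh5]
  have hLh : L * h ^ 2 ≤ c := by
    have : (L * h ^ 2) ^ 2 ≤ M := by rw [hh4] at hLn; linarith
    nlinarith
  obtain ⟨k₀, hk₀, c1, c2, c3⟩ := exists_center hp0 hp1 n
  set j₀ := n - k₀ with hj₀
  have hi : n * (p * (1 - p)) ≤ (k₀ : ℝ) + 1 := by nlinarith [mul_pos hnpos hp0]
  have hj : n * (p * (1 - p)) ≤ (j₀ : ℝ) + 1 := by nlinarith [mul_pos hnpos hp0]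
  set l := (m (k₀ + 1) - m k₀) - (m (j₀ + 1) - m j₀) with hl
  have hlb : |l| ≤ L / (p * (1 - p)) := by
    rcases le_total k₀ j₀ with h' | h'
    · rw [hl, abs_sub_comm]
      exact abs_diff_sub_diff_le hp0 hp1 hL H hn h' (Nat.sub_le _ _) hi
    · exact abs_diff_sub_diff_le hp0 hp1 hL H hn h' hk₀ hj
  have hlc : |l| ≤ c * L := by
    refine hlb.trans ?_
    have : L / (p * (1 - p)) = L * (1 / (p * (1 - p))) := by ring
    have h12 : 12 / (p * (1 - p)) = 12 * (1 / (p * (1 - p))) := by ring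
    have : 0 < 1 / (p * (1 - p)) := by positivity
    nlinarith
  have hdev : ∀ k : ℕ, ((k : ℝ) - n * p) ^ 2 = n * (binDev p n k - 1) := fun k => by
    rw [binDev]; field_simp; ring
  have hu1 := one_le_binDev p n
  have hx : ∀ k ≤ n, |(k : ℝ) - n * p| ≤ h ^ 2 * binDev p n k := fun k _ => by
    refine abs_le_of_sq_le_sq ?_ (by have := hu1 k; positivity)
    rw [hdev, hh4]
    have : binDev p n k - 1 ≤ binDev p n k ^ 2 := by nlinarith [hu1 k]
    calc h ^ 4 * (binDev p n k - 1) ≤ h ^ 4 * binDev p n k ^ 2 := by gcongr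
      _ = (h ^ 2 * binDev p n k) ^ 2 := by ring
  have hsqk : ∀ k : ℕ, ((k : ℝ) - k₀) ^ 2 ≤ 2 * n * binDev p n k := fun k => by
    refine (sq_sub_center_le c3 k).trans ?_
    rw [hdev]; nlinarith
  have hkk : ∀ k ≤ n, |(k : ℝ) - k₀| ≤ 2 * (h ^ 2 * binDev p n k) := fun k hk => by
    have e : (k : ℝ) - k₀ = (k - n * p) - (k₀ - n * p) := by ring
    rw [e]
    refine (abs_sub _ _).trans ?_
    have := hx k hk
    nlinarith [one_le_pow₀ hh1 (n := 2), hu1 k]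
  have hcast : ∀ k ≤ n, ((n - k : ℕ) : ℝ) - (j₀ : ℝ) = -((k : ℝ) - k₀) := fun k hk => by
    rw [hj₀, Nat.cast_sub hk, Nat.cast_sub hk₀]; ring
  -- the nonlinear part of the toll
  set e : ℕ → ℝ := fun k => m k + m (n - k) - l * ((k : ℝ) - n * p) with he
  have hEe : binE p n e = binE p n (fun k => m k + m (n - k)) := by
    rw [he, binE_sub, binE_mul_left, binE_centered]; ring
  have heb : ∀ k ≤ n, |e k - (m k₀ + m j₀ - l * (k₀ - n * p))| ≤
      (4 / (p * (1 - p)) * L) * binDev p n k := fun k hk => by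
    have t1 := taylor_le hL H k k₀
    have t2 := taylor_le hL H (n - k) j₀
    rw [hcast k hk, neg_sq] at t2
    have e1 : e k - (m k₀ + m j₀ - l * (k₀ - n * p)) =
        (m k - m k₀ - (m (k₀ + 1) - m k₀) * ((k : ℝ) - k₀)) +
        (m (n - k) - m j₀ - (m (j₀ + 1) - m j₀) * -((k : ℝ) - k₀)) := by
      simp only [he, hl]; ring
    rw [e1]
    refine (abs_add_le _ _).trans ((add_le_add t1 t2).trans ?_)
    have hnp : 0 < n * p := by positivity
    have hnq : 0 < n * (1 - p) := mul_pos hnpos (by linarith)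
    calc _ ≤ 2 * L * (((k : ℝ) - k₀) ^ 2 / (n * p)) +
          2 * L * (((k : ℝ) - k₀) ^ 2 / (n * (1 - p))) := by gcongr
      _ = 2 * L * (((k : ℝ) - k₀) ^ 2 / (n * (p * (1 - p)))) := by
          have : 1 - p ≠ 0 := by linarith
          field_simp; ring
      _ ≤ 2 * L * ((2 * n * binDev p n k) / (n * (p * (1 - p)))) := by gcongr; exact hsqk k
      _ = _ := by field_simp; ring
  set r : ℕ → ℝ := fun k => e k - binE p n e with hr
  have hrb : ∀ k ≤ n, |r k| ≤ c * L * binDev p n k := fun k hk => by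
    refine (abs_sub_binE_le hn hp0 hp1 (by positivity) heb k hk).trans ?_
    have : 3 * (4 / (p * (1 - p)) * L) = 12 / (p * (1 - p)) * L := by ring
    rw [this]
    have := hu1 k
    gcongr
  have hr0 : binE p n r = 0 := by rw [hr, binE_sub, binE_const, sub_self]
  -- the fluctuation of the variance
  set B := A * L ^ 2 * (2 * h) with hB
  have hBΔ : ∀ k ≤ n, |V (k + 1) - V k| ≤ B := fun k hk => by
    refine (hΔ k).trans ?_
    rw [hB]
    gcongr
    have hk' : (k : ℝ) ≤ n := by exact_mod_cast hk
    calc ((k : ℝ) + 1) ^ (1 / 4 : ℝ) ≤ (2 ^ 4 * (n : ℝ)) ^ (1 / 4 : ℝ) := by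
          gcongr; linarith
      _ = 2 * h := by
          rw [Real.mul_rpow (by norm_num) hnpos.le, ← Real.rpow_natCast, ← Real.rpow_mul (by norm_num)]
          norm_num [hh]
  set g : ℕ → ℝ := fun k => (V k + V (n - k)) / 2 with hg
  have hgb : ∀ k ≤ n, |g k - (V k₀ + V j₀) / 2| ≤ (4 * A * L ^ 2 * h ^ 3) * binDev p n k :=
    fun k hk => by
    have t1 := sub_le_of_diff hBΔ hk hk₀
    have t2 := sub_le_of_diff hBΔ (Nat.sub_le n k) (Nat.sub_le n k₀)
    rw [← hj₀, hcast k hk, abs_neg] at t2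
    have e1 : g k - (V k₀ + V j₀) / 2 = (V k - V k₀) / 2 + (V (n - k) - V j₀) / 2 := by
      simp only [hg]; ring
    rw [e1]
    refine (abs_add_le _ _).trans ?_
    rw [abs_div, abs_div, abs_two]
    have hB0 : 0 ≤ B := by positivity
    have t3 := mul_le_mul_of_nonneg_left (hkk k hk) hB0
    calc _ ≤ B * (2 * (h ^ 2 * binDev p n k)) := by linarith
      _ = _ := by rw [hB]; ring
  set w : ℕ → ℝ := fun k => g k - binE p n g with hw
  have hwb : ∀ k ≤ n, |w k| ≤ c * L ^ 2 * h ^ 3 * binDev p n k := fun k hk => by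
    refine (abs_sub_binE_le hn hp0 hp1 (by positivity) hgb k hk).trans ?_
    have : 3 * (4 * A * L ^ 2 * h ^ 3) = 12 * A * L ^ 2 * h ^ 3 := by ring
    rw [this]
    have := hu1 k
    gcongr
  have hw0 : binE p n w = 0 := by rw [hw, binE_sub, binE_const, sub_self]
  have ha : 0 ≤ binE p n g :=
    binE_nonneg hp0.le hp1.le fun k _ => by simp only [hg]; linarith [hV0 k, hV0 (n - k)]
  have key := norm_binE_gaussian_step_le hp0.le hp1.le hc1 hL hh1 hh4 hLh hlc ha
    (fun k _ => hu1 k) hx hrb hwb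
    (fun k _ => by simp only [hw, hg]; linarith [hV0 k, hV0 (n - k)]) hr0 hw0
    ((binE_binDev_pow_three_le hp0.le hp1.le hn).trans hce)
  have e1 : ∀ k : ℕ, l * ((k : ℝ) - n * p) + r k =
      m k + m (n - k) - binE p n (fun k => m k + m (n - k)) := fun k => by
    simp only [hr, hEe]; simp only [he]; ring
  have e2 : ∀ k : ℕ, (Real.exp (-(binE p n g + w k)) : ℂ) =
      Real.exp (-(V k / 2)) * Real.exp (-(V (n - k) / 2)) := fun k => by
    rw [← Complex.ofReal_mul, ← Real.exp_add]
    simp only [hw, hg]; congr 2; ring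
  have e3 : binE p n g + binE p n (fun k => (l * ((k : ℝ) - n * p) + r k) ^ 2) / 2 = V n / 2 := by
    simp only [e1]
    have hgE : binE p n g = binE p n (fun k => V k + V (n - k)) / 2 := by
      have : g = fun k => (1 / 2) * (V k + V (n - k)) := by ext k; simp only [hg]; ring
      rw [this, binE_mul_left]; ring
    rw [hgE, hV, tollVar_eq]; ring
  rw [e3] at key
  simpa only [e1, e2] using key

lemma binE_rpow_le {p : ℝ} (hp0 : 0 < p) (hp1 : p < 1) {n : ℕ} (hn : 2 ≤ n) :
    binE p n (fun k => (k : ℝ) ^ (5 / 4 : ℝ) + ((n - k : ℕ) : ℝ) ^ (5 / 4 : ℝ)) ≤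
      (1 - p * (1 - p) / 4) * (n : ℝ) ^ (5 / 4 : ℝ) := by
  have hn' : (2 : ℝ) ≤ n := by exact_mod_cast hn
  have hn0 : (0 : ℝ) < n := by linarith
  have hpow : ∀ x : ℝ, 0 ≤ x → x ^ (5 / 4 : ℝ) = x ^ (1 / 4 : ℝ) * x := fun x hx => by
    rw [← Real.rpow_add_one' hx (by norm_num)]; norm_num
  have hle : ∀ x : ℝ, 0 ≤ x → x ^ (5 / 4 : ℝ) ≤ (n : ℝ) ^ (1 / 4 : ℝ) * (x - x * (n - x) / (4 * n)) :=
    fun x hx => by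
    rw [hpow x hx]
    have := rpow_le_of_le (s := 1 / 4) (by norm_num) (by norm_num) hn0 hx
    calc x ^ (1 / 4 : ℝ) * x ≤ ((n : ℝ) ^ (1 / 4 : ℝ) * (1 - 1 / 4 * (1 - x / n))) * x := by gcongr
      _ = _ := by field_simp
  calc _ ≤ binE p n (fun k => ((n : ℝ) ^ (1 / 4 : ℝ) * n - (n : ℝ) ^ (1 / 4 : ℝ) * p * (1 - p) / 2 *
          n) + (n : ℝ) ^ (1 / 4 : ℝ) * (-(1 - 2 * p) / 2) * ((k : ℝ) - n * p) +
          (n : ℝ) ^ (1 / 4 : ℝ) * (1 / (2 * n)) * ((k : ℝ) - n * p) ^ 2) := by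
        refine binE_mono hp0.le hp1.le fun k hk => ?_
        refine (add_le_add (hle k (by positivity)) (hle (n - k : ℕ) (by positivity))).trans ?_
        rw [Nat.cast_sub hk]
        apply le_of_eq
        field_simp
        ring
    _ = (n : ℝ) ^ (1 / 4 : ℝ) * (n - p * (1 - p) * (n - 1) / 2) := by
        rw [binE_add, binE_add, binE_const, binE_mul_left, binE_mul_left, binE_centered,
          binE_centered_sq]
        field_simp
        ring
    _ ≤ (n : ℝ) ^ (1 / 4 : ℝ) * ((1 - p * (1 - p) / 4) * n) := by
        gcongr
        have : 0 < p * (1 - p) := mul_pos hp0 (by linarith)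
        nlinarith
    _ = _ := by rw [hpow _ hn0.le]; ring

lemma exists_norm_charFun_sub_le {p A M : ℝ} (hp0 : 0 < p) (hp1 : p < 1) (hA : 0 ≤ A)
    (hM : 0 ≤ M) :
    ∃ C, 0 ≤ C ∧ ∀ (L : ℝ) (m V : ℕ → ℝ) (ψ : ℕ → ℂ), 0 ≤ L →
      (∀ n : ℕ, |m (n + 2) - 2 * m (n + 1) + m n| ≤ L / (n + 1)) →
      (∀ n : ℕ, |V (n + 1) - V n| ≤ A * L ^ 2 * ((n : ℝ) + 1) ^ (1 / 4 : ℝ)) →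
      (∀ n, 0 ≤ V n) → V 0 = 0 → V 1 = 0 → ψ 0 = 1 → ψ 1 = 1 → (∀ n, ‖ψ n‖ ≤ 1) →
      (∀ n, 2 ≤ n → V n = binE p n (fun k => V k + V (n - k)) + tollVar p m n) →
      (∀ n, 2 ≤ n → ψ n = binE p n (fun k => ψ k * ψ (n - k) *
        Complex.exp (Complex.I *
          (m k + m (n - k) - binE p n (fun k => m k + m (n - k)) : ℝ)))) →
      ∀ n : ℕ, L ^ 2 * n ≤ M →
      ‖ψ n - (Real.exp (-(V n / 2)) : ℝ)‖ ≤ C * (L ^ 3 * (n : ℝ) ^ (5 / 4 : ℝ)) := by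
  obtain ⟨C, hC, hstep⟩ := exists_norm_binE_step_le hp0 hp1 hA hM
  have hpq : 0 < p * (1 - p) := mul_pos hp0 (by linarith)
  refine ⟨4 * C / (p * (1 - p)), by positivity, ?_⟩
  intro L m V ψ hL H hΔ hV0 hVz hVo hψz hψo hψ hV hψrec n hLn
  set K := 4 * C / (p * (1 - p)) * L ^ 3 with hK
  have hK0 : 0 ≤ K := by positivity
  suffices h : ‖ψ n - (Real.exp (-(V n / 2)) : ℝ)‖ - K * (n : ℝ) ^ (5 / 4 : ℝ) ≤ 0 by
    rw [hK] at h; linarith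
  refine binE_induction_of_le hp0 hp1 zero_le_one le_rfl zero_le_one le_rfl
    (D := fun n => ‖ψ n - (Real.exp (-(V n / 2)) : ℝ)‖ - K * (n : ℝ) ^ (5 / 4 : ℝ)) ?_ ?_ ?_
  · simp [hψz, hVz]
  · simp [hψo, hVo, hK0]
  intro j hj hjn
  have hLj : L ^ 2 * j ≤ M := by
    refine le_trans ?_ hLn
    gcongr
  have h1 := hstep L m V hL H hΔ hV0 j (by omega) hLj (hV j hj)
  set g : ℕ → ℂ := fun k => Complex.exp (Complex.I *
          (m k + m (j - k) - binE p j (fun k => m k + m (j - k)) : ℝ)) with hg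
  set G : ℕ → ℂ := fun k => ((Real.exp (-(V k / 2)) : ℝ) : ℂ) with hG
  have hG1 : ∀ k, ‖G k‖ ≤ 1 := fun k => by
    simp only [hG]
    rw [Complex.norm_real, Real.norm_of_nonneg (Real.exp_pos _).le, Real.exp_le_one_iff]
    linarith [hV0 k]
  have h2 : ‖ψ j - binE p j (fun k => G k * G (j - k) * g k)‖ ≤
      binE p j (fun k => ‖ψ k - G k‖ + ‖ψ (j - k) - G (j - k)‖) := by
    rw [hψrec j hj, ← binE_sub]
    refine norm_binE_le_of_le hp0.le hp1.le fun k _ => ?_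
    have e : ψ k * ψ (j - k) * g k - G k * G (j - k) * g k =
        ((ψ k - G k) * ψ (j - k) + G k * (ψ (j - k) - G (j - k))) * g k := by ring
    have hg1 : ‖g k‖ = 1 := norm_cexp_I _
    change ‖ψ k * ψ (j - k) * g k - G k * G (j - k) * g k‖ ≤ _
    rw [e, norm_mul, hg1, mul_one]
    refine (norm_add_le _ _).trans ?_
    rw [norm_mul, norm_mul]
    have := mul_le_mul_of_nonneg_left (hψ (j - k)) (norm_nonneg (ψ k - G k))
    have := mul_le_mul_of_nonneg_right (hG1 k) (norm_nonneg (ψ (j - k) - G (j - k)))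
    linarith
  have h3 := binE_rpow_le hp0 hp1 hj
  have h4 : ‖ψ j - G j‖ ≤ binE p j (fun k => ‖ψ k - G k‖ + ‖ψ (j - k) - G (j - k)‖) +
      C * (L ^ 3 * (j : ℝ) ^ (5 / 4 : ℝ)) := by
    have e : ψ j - G j = (ψ j - binE p j (fun k => G k * G (j - k) * g k)) +
      (binE p j (fun k => G k * G (j - k) * g k) - G j) := by ring
    rw [e]
    exact (norm_add_le _ _).trans (add_le_add h2 h1)
  have e5 : binE p j (fun k => 1 * (‖ψ k - G k‖ - K * (k : ℝ) ^ (5 / 4 : ℝ)) +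
      1 * (‖ψ (j - k) - G (j - k)‖ - K * ((j - k : ℕ) : ℝ) ^ (5 / 4 : ℝ))) =
      binE p j (fun k => ‖ψ k - G k‖ + ‖ψ (j - k) - G (j - k)‖) -
        K * binE p j (fun k => (k : ℝ) ^ (5 / 4 : ℝ) + ((j - k : ℕ) : ℝ) ^ (5 / 4 : ℝ)) := by
    rw [← binE_mul_left, ← binE_sub]
    congr 1; ext k; ring
  change ‖ψ j - G j‖ - _ ≤ binE p j (fun k => 1 * (‖ψ k - G k‖ - K * (k : ℝ) ^ (5 / 4 : ℝ)) +
      1 * (‖ψ (j - k) - G (j - k)‖ - K * ((j - k : ℕ) : ℝ) ^ (5 / 4 : ℝ)))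
  rw [e5]
  have h6 := mul_le_mul_of_nonneg_left h3 hK0
  have h7 : K * (p * (1 - p) / 4) = C * L ^ 3 := by
    have : 1 - p ≠ 0 := by linarith
    rw [hK]; field_simp
  have h8 : K * (p * (1 - p) / 4) * (j : ℝ) ^ (5 / 4 : ℝ) = C * L ^ 3 * (j : ℝ) ^ (5 / 4 : ℝ) := by
    rw [h7]
  linarith

lemma sqrt_add_sqrt_ge {n k : ℕ} (hn : 1 ≤ n) (hk : k ≤ n) :
    √n * (1 + (k : ℝ) * ((n - k : ℕ) : ℝ) / n ^ 2) ≤ √k + √((n - k : ℕ) : ℝ) := by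
  have hn' : (0 : ℝ) < n := by exact_mod_cast hn
  have hs := Real.sq_sqrt (Nat.cast_nonneg (α := ℝ) k)
  have hu := Real.sq_sqrt (Nat.cast_nonneg (α := ℝ) (n - k))
  have hN := Real.sq_sqrt hn'.le
  have hN0 := Real.sqrt_pos.2 hn'
  have hs0 := Real.sqrt_nonneg (k : ℝ)
  have hu0 := Real.sqrt_nonneg ((n - k : ℕ) : ℝ)
  set s := √(k : ℝ)
  set u := √((n - k : ℕ) : ℝ)
  set N := √(n : ℝ)
  have hsum : s ^ 2 + u ^ 2 = N ^ 2 := by rw [hs, hu, hN, Nat.cast_sub hk]; ring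
  rw [← hs, ← hu, ← hN]
  set z := s * u / N ^ 2 with hz
  have hzs : s * u = z * N ^ 2 := by rw [hz]; field_simp
  have hz0 : 0 ≤ z := by positivity
  have hz1 : z ≤ 1 / 2 := by
    rw [hz, div_le_iff₀ (by positivity)]; nlinarith [sq_nonneg (s - u)]
  have e : s ^ 2 * u ^ 2 / (N ^ 2) ^ 2 = z ^ 2 := by rw [hz]; field_simp
  rw [e]
  refine (abs_le_of_sq_le_sq' ?_ (by positivity)).2
  have : (s + u) ^ 2 = N ^ 2 * (1 + 2 * z) := by nlinarith
  rw [this, mul_pow]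
  gcongr
  nlinarith [mul_nonneg hz0 hz0, mul_nonneg hz0 (sub_nonneg.2 hz1),
    mul_nonneg (mul_nonneg hz0 hz0) (sub_nonneg.2 hz1),
    mul_nonneg (mul_nonneg (mul_nonneg hz0 hz0) hz0) (sub_nonneg.2 hz1)]

lemma binE_sqrt_ge {p : ℝ} (hp0 : 0 < p) (hp1 : p < 1) {n : ℕ} (hn : 2 ≤ n) :
    √n * (1 + p * (1 - p) / 2) ≤ binE p n (fun k => √k + √((n - k : ℕ) : ℝ)) := by
  have hn' : (2 : ℝ) ≤ n := by exact_mod_cast hn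
  have hn0 : (0 : ℝ) < n := by linarith
  have hpq : 0 < p * (1 - p) := mul_pos hp0 (by linarith)
  calc √n * (1 + p * (1 - p) / 2) ≤ √n * (1 + p * (1 - p) * ((n - 1) / n)) := by
        have : (1 : ℝ) / 2 ≤ (n - 1) / n := by rw [div_le_div_iff₀ two_pos hn0]; linarith
        gcongr
        nlinarith
    _ = binE p n (fun k => √n * (1 + p * (1 - p)) + (√n * ((1 - 2 * p) / n)) * ((k : ℝ) - n * p) +
          (√n * (-1 / n ^ 2)) * ((k : ℝ) - n * p) ^ 2) := by
        rw [binE_add, binE_add, binE_const, binE_mul_left, binE_mul_left, binE_centered,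
          binE_centered_sq]
        field_simp
        ring
    _ ≤ _ := by
        refine binE_mono hp0.le hp1.le fun k hk => ?_
        refine le_trans (le_of_eq ?_) (sqrt_add_sqrt_ge (by omega) hk)
        rw [Nat.cast_sub hk]
        field_simp
        ring

lemma var_three_ge {p a b : ℝ} (hp0 : 0 < p) (hp1 : p < 1) {m V : ℕ → ℝ}
    (hm0 : m 0 = 0) (hm1 : m 1 = 0) (hV0 : V 0 = 0) (hV1 : V 1 = 0)
    (hm : ∀ n, 2 ≤ n → m n = binE p n (fun k => m k + m (n - k)) + (a + b * n))
    (hV : ∀ n, 2 ≤ n → V n = binE p n (fun k => V k + V (n - k)) + tollVar p m n) :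
    (|a| + |b|) ^ 2 / 60 ≤ V 3 := by
  have hpq : 0 < p * (1 - p) := mul_pos hp0 (by linarith)
  have hpq4 : p * (1 - p) ≤ 1 / 4 := by nlinarith [sq_nonneg (p - 1 / 2)]
  have hm2 := hm 2 le_rfl
  have hm3 := hm 3 (by norm_num)
  have hV2 := hV 2 le_rfl
  have hV3 := hV 3 (by norm_num)
  simp only [tollVar, binE, binWeight, Finset.sum_range_succ, Finset.sum_range_zero, smul_eq_mul,
    hm0, hm1, hV0, hV1] at hm2 hm3 hV2 hV3
  norm_num [hm0, hm1, hV0, hV1, Nat.choose] at hm2 hm3 hV2 hV3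
  set t := p * (1 - p) with ht
  have a2 : 2 * t * m 2 = a + 2 * b := by rw [ht]; linear_combination hm2
  have a3 : 3 * t * (m 3 - m 2) = a + 3 * b := by rw [ht]; linear_combination hm3
  have b2 : V 2 = (1 - 2 * t) * m 2 ^ 2 := by
    have : 2 * t * V 2 = 2 * t * ((1 - 2 * t) * m 2 ^ 2) := by rw [ht]; linear_combination hV2
    exact mul_left_cancel₀ (by positivity) this
  have b3 : V 3 = V 2 + (1 - 3 * t) * (m 3 - m 2) ^ 2 := by
    have : 3 * t * V 3 = 3 * t * (V 2 + (1 - 3 * t) * (m 3 - m 2) ^ 2) := by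
      rw [ht]; linear_combination hV3
    exact mul_left_cancel₀ (by positivity) this
  rw [b3, b2]
  set x := m 2
  set y := m 3 - m 2
  have hx : |a + 2 * b| ≤ |x| / 2 := by
    rw [← a2, abs_mul, abs_of_pos (by positivity)]; nlinarith [abs_nonneg x]
  have hy : |a + 3 * b| ≤ 3 / 4 * |y| := by
    rw [← a3, abs_mul, abs_of_pos (by positivity)]; nlinarith [abs_nonneg y]
  have ha : |a| ≤ 3 * |a + 2 * b| + 2 * |a + 3 * b| := by
    have : a = 3 * (a + 2 * b) - 2 * (a + 3 * b) := by ring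
    calc |a| = |3 * (a + 2 * b) - 2 * (a + 3 * b)| := by rw [← this]
      _ ≤ |3 * (a + 2 * b)| + |2 * (a + 3 * b)| := abs_sub _ _
      _ = _ := by rw [abs_mul, abs_mul]; norm_num
  have hb : |b| ≤ |a + 2 * b| + |a + 3 * b| := by
    have : b = (a + 3 * b) - (a + 2 * b) := by ring
    calc |b| = |(a + 3 * b) - (a + 2 * b)| := by rw [← this]
      _ ≤ |a + 3 * b| + |a + 2 * b| := abs_sub _ _
      _ = _ := add_comm _ _
  have hr : |a| + |b| ≤ 2 * |x| + 9 / 4 * |y| := by linarith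
  have hr2 : (|a| + |b|) ^ 2 ≤ (2 * |x| + 9 / 4 * |y|) ^ 2 := by gcongr
  rw [← sq_abs x, ← sq_abs y]
  nlinarith [sq_nonneg (9 / 4 * |x| - 2 * |y|), sq_nonneg |x|, sq_nonneg |y|]

lemma exists_var_ge {p : ℝ} (hp0 : 0 < p) (hp1 : p < 1) :
    ∃ c, 0 < c ∧ ∀ (a b : ℝ) (m V : ℕ → ℝ), m 0 = 0 → m 1 = 0 → V 0 = 0 → V 1 = 0 →
      (∀ n, 0 ≤ V n) →
      (∀ n, 2 ≤ n → m n = binE p n (fun k => m k + m (n - k)) + (a + b * n)) →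
      (∀ n, 2 ≤ n → V n = binE p n (fun k => V k + V (n - k)) + tollVar p m n) →
      ∀ n : ℕ, 16 ≤ n → c * (|a| + |b|) ^ 2 * n ≤ V n := by
  have hq : 0 < 1 - p := by linarith
  have hpq : 0 < p * (1 - p) := mul_pos hp0 hq
  obtain ⟨n₂, hn₂⟩ := exists_nat_ge ((8 / (p * (1 - p))) ^ 2)
  have hn₂1 : 1 ≤ n₂ := by
    have : (0 : ℝ) < n₂ := lt_of_lt_of_le (by positivity) hn₂
    exact_mod_cast this
  have hn₂' : (1 : ℝ) ≤ n₂ := by exact_mod_cast hn₂1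
  set c := p ^ 3 * (1 - p) ^ n₂ / (120 * n₂) with hc
  have hc0 : 0 < c := by positivity
  refine ⟨c, hc0, ?_⟩
  intro a b m V hm0 hm1 hV0 hV1 hV hmrec hVrec
  set r := (|a| + |b|) ^ 2 with hr
  have hr0 : 0 ≤ r := by positivity
  have h3 := var_three_ge hp0 hp1 hm0 hm1 hV0 hV1 hmrec hVrec
  have htoll : ∀ n, 0 ≤ tollVar p m n := fun n => by
    rw [tollVar_eq]; exact binE_nonneg hp0.le hp1.le fun k _ => sq_nonneg _
  set l : ℕ → ℝ := fun n => n + √n - 4 with hl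
  have hsqn : ∀ n : ℕ, 1 ≤ n → √(n : ℝ) ≤ n := fun n hn => by
    have : (1 : ℝ) ≤ n := by exact_mod_cast hn
    exact Real.sqrt_le_iff.2 ⟨by linarith, by nlinarith⟩
  have key : ∀ n, max (c * r * l n - V n) 0 ≤ 0 := by
    have hsmall : ∀ n, n ≤ 2 → l n ≤ 0 := fun n hn => by
      simp only [hl]
      rcases Nat.eq_zero_or_pos n with rfl | hn0
      · norm_num
      · have : (n : ℝ) ≤ 2 := by exact_mod_cast hn
        have := hsqn n hn0
        linarith
    have hsmall' : ∀ n, n ≤ 2 → c * r * l n - V n ≤ 0 := fun n hn => by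
      have := mul_nonpos_of_nonneg_of_nonpos (mul_nonneg hc0.le hr0) (hsmall n hn)
      linarith [hV n]
    refine binE_induction hp0 hp1 zero_le_one le_rfl zero_le_one le_rfl
      (D := fun n => max (c * r * l n - V n) 0) ?_ ?_ ?_
    · exact max_le (hsmall' 0 (by norm_num)) le_rfl
    · exact max_le (hsmall' 1 (by norm_num)) le_rfl
    intro n hn
    have hR : 0 ≤ binE p n (fun k => 1 * max (c * r * l k - V k) 0 +
        1 * max (c * r * l (n - k) - V (n - k)) 0) :=
      binE_nonneg hp0.le hp1.le fun k _ => by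
        have := le_max_right (c * r * l k - V k) 0
        have := le_max_right (c * r * l (n - k) - V (n - k)) 0
        linarith
    refine max_le ?_ hR
    rcases le_total n n₂ with hle | hge
    · refine le_trans ?_ hR
      rcases Nat.lt_or_ge n 3 with h | h
      · exact hsmall' n (by omega)
      have h1 : binWeight p n 3 * V 3 ≤ V n := by
        have h1 := binWeight_mul_le_binE hp0.le hp1.le h (g := fun k => V k + V (n - k))
          fun k _ => add_nonneg (hV _) (hV _)
        have h2 := hVrec n hn
        have h4 := mul_nonneg (binWeight_nonneg hp0.le hp1.le n 3) (hV (n - 3))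
        linarith [htoll n]
      have h2 : p ^ 3 * (1 - p) ^ n₂ ≤ binWeight p n 3 := by
        have hch : (1 : ℝ) ≤ n.choose 3 := by exact_mod_cast Nat.choose_pos h
        have hpw : (1 - p) ^ n₂ ≤ (1 - p) ^ (n - 3) :=
          pow_le_pow_of_le_one hq.le (by linarith) (by omega)
        rw [binWeight]
        calc p ^ 3 * (1 - p) ^ n₂ = 1 * p ^ 3 * (1 - p) ^ n₂ := by ring
          _ ≤ _ := by gcongr
      have h4 : l n ≤ 2 * n₂ := by
        have := hsqn n (by omega)
        have : (n : ℝ) ≤ n₂ := by exact_mod_cast hle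
        simp only [hl]; linarith
      have h5 : c * r * l n ≤ c * r * (2 * n₂) := by gcongr
      have h6 : c * r * (2 * n₂) = p ^ 3 * (1 - p) ^ n₂ * (r / 60) := by
        rw [hc]; field_simp; ring
      have h7 : p ^ 3 * (1 - p) ^ n₂ * (r / 60) ≤ binWeight p n 3 * V 3 :=
        mul_le_mul h2 h3 (by positivity) (binWeight_nonneg hp0.le hp1.le n 3)
      linarith
    · have hln : l n ≤ binE p n (fun k => l k + l (n - k)) := by
        have h1 := binE_sqrt_ge hp0 hp1 hn
        have e : binE p n (fun k => l k + l (n - k)) =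
            (n - 8) + binE p n (fun k => √k + √((n - k : ℕ) : ℝ)) := by
          rw [← binE_const p n ((n : ℝ) - 8), ← binE_add]
          refine binE_congr fun k hk => ?_
          simp only [hl]; rw [Nat.cast_sub hk]; ring
        have h2 : 8 / (p * (1 - p)) ≤ √n := by
          refine Real.le_sqrt_of_sq_le (hn₂.trans ?_)
          exact_mod_cast hge
        have h3 : 4 ≤ √n * (p * (1 - p) / 2) := by
          rw [div_le_iff₀ hpq] at h2; linarith
        rw [e]
        simp only [hl]
        linarith
      calc c * r * l n - V n ≤ c * r * binE p n (fun k => l k + l (n - k)) -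
            binE p n (fun k => V k + V (n - k)) := by
            have := mul_le_mul_of_nonneg_left hln (mul_nonneg hc0.le hr0)
            linarith [htoll n, hVrec n hn]
        _ = binE p n (fun k => c * r * (l k + l (n - k)) - (V k + V (n - k))) := by
            rw [binE_sub, binE_mul_left]
        _ ≤ _ := binE_mono hp0.le hp1.le fun k _ => by
            have := le_max_left (c * r * l k - V k) 0
            have := le_max_left (c * r * l (n - k) - V (n - k)) 0
            linarith
  intro n hn
  have h1 := (le_max_left _ _).trans (key n)
  have h2 : 4 ≤ √(n : ℝ) := by
    refine Real.le_sqrt_of_sq_le ?_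
    have : (16 : ℝ) ≤ n := by exact_mod_cast hn
    linarith
  have h4 : c * r * n ≤ c * r * l n := by
    gcongr
    simp only [hl]; linarith
  linarith

/-- Combination of two independent pairs at the root of a trie with `n` strings. -/
def trieJoin (n : ℕ) (z : (ℕ × ℕ) × (ℕ × ℕ)) : ℕ × ℕ :=
  (z.1.1 + z.2.1 + 1, z.1.2 + z.2.2 + n)

lemma measurable_trieStep (n : ℕ) : Measurable (trieStep n) := by
  refine measurable_from_prod_countable_right fun k => ?_
  have h : Measurable fun ω : (ℕ → ℕ × ℕ) × (ℕ → ℕ × ℕ) => (ω.1 k, ω.2 (n - k)) := by fun_prop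
  exact (Measurable.of_discrete (f := trieJoin n)).comp h

namespace IsTriePairFamily

variable {p : ℝ} {μ : ℕ → Measure (ℕ × ℕ)}

lemma eq_sum_map_trieJoin (h : IsTriePairFamily p μ) {n : ℕ} (hn : 2 ≤ n) :
    μ n = ∑ k ∈ Finset.range (n + 1), ENNReal.ofReal (binWeight p n k) •
      ((μ k).prod (μ (n - k))).map (trieJoin n) := by
  obtain ⟨P, hP, hB, h1, h2, hind, hμ⟩ := h.recur n hn
  have hm1 : Measurable fun ω : ℕ × ((ℕ → ℕ × ℕ) × (ℕ → ℕ × ℕ)) => ω.2.1 := by fun_prop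
  have hm2 : Measurable fun ω : ℕ × ((ℕ → ℕ × ℕ) × (ℕ → ℕ × ℕ)) => ω.2.2 := by fun_prop
  set Q₁ := P.map fun ω => ω.2.1 with hQ₁
  set Q₂ := P.map fun ω => ω.2.2 with hQ₂
  have : IsProbabilityMeasure Q₁ := Measure.isProbabilityMeasure_map hm1.aemeasurable
  have : IsProbabilityMeasure Q₂ := Measure.isProbabilityMeasure_map hm2.aemeasurable
  have e1 : ∀ k, Q₁.map (fun ω => ω k) = μ k := fun k => by
    rw [← h1 k, hQ₁, Measure.map_map (measurable_pi_apply k) hm1]; rfl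
  have e2 : ∀ k, Q₂.map (fun ω => ω k) = μ k := fun k => by
    rw [← h2 k, hQ₂, Measure.map_map (measurable_pi_apply k) hm2]; rfl
  ext s hs
  rw [hμ, Measure.map_apply (measurable_trieStep n) hs, hind, hB,
    Measure.prod_apply (measurable_trieStep n hs), binomialMeasure, lintegral_finsetSum_measure,
    Measure.finsetSum_apply]
  refine Finset.sum_congr rfl fun k _ => ?_
  rw [lintegral_smul_measure, lintegral_dirac, Measure.smul_apply,
    Measure.map_apply Measurable.of_discrete hs, ← e1 k, ← e2 (n - k),
    Measure.map_prod_map _ _ (measurable_pi_apply k) (measurable_pi_apply (n - k)),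
    Measure.map_apply (by fun_prop) (.of_discrete)]
  rfl

lemma integral_eq_binE {E : Type*} [NormedAddCommGroup E] [NormedSpace ℝ E]
    (h : IsTriePairFamily p μ) (hp0 : 0 ≤ p) (hp1 : p ≤ 1) {n : ℕ} (hn : 2 ≤ n) {f : ℕ × ℕ → E}
    (hf : Integrable f (μ n)) :
    ∫ x, f x ∂μ n = binE p n fun k => ∫ z, f (trieJoin n z) ∂(μ k).prod (μ (n - k)) := by
  have hs := h.eq_sum_map_trieJoin hn
  rw [hs] at hf ⊢
  rw [integral_finsetSum_measure fun i hi => integrable_finsetSum_measure.1 hf i hi, binE]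
  refine Finset.sum_congr rfl fun k hk => ?_
  rw [integral_smul_measure, ENNReal.toReal_ofReal (binWeight_nonneg hp0 hp1 n k),
    integral_map Measurable.of_discrete.aemeasurable .of_discrete]

end IsTriePairFamily

lemma integral_add_add_prod {α β : Type*} [MeasurableSpace α] [MeasurableSpace β] {ν : Measure α}
    {ρ : Measure β} [IsProbabilityMeasure ν] [IsProbabilityMeasure ρ] {f : α → ℝ} {g : β → ℝ}
    (hf : Integrable f ν) (hg : Integrable g ρ) (c : ℝ) :
    ∫ z, (f z.1 + g z.2 + c) ∂ν.prod ρ = ∫ x, f x ∂ν + ∫ y, g y ∂ρ + c := by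
  have i : Integrable (fun z : α × β => f z.1 + g z.2) (ν.prod ρ) :=
    (hf.comp_fst ρ).add (hg.comp_snd ν)
  rw [integral_add i (integrable_const c),
    integral_add (hf.comp_fst ρ) (hg.comp_snd ν), integral_fun_fst, integral_fun_snd]
  simp

lemma integral_add_add_sq_prod {α β : Type*} [MeasurableSpace α] [MeasurableSpace β] {ν : Measure α}
    {ρ : Measure β} [IsProbabilityMeasure ν] [IsProbabilityMeasure ρ] {f : α → ℝ} {g : β → ℝ}
    (hf : MemLp f 2 ν) (hg : MemLp g 2 ρ) (hf0 : ∫ x, f x ∂ν = 0) (hg0 : ∫ y, g y ∂ρ = 0) (c : ℝ) :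
    ∫ z, (f z.1 + g z.2 + c) ^ 2 ∂ν.prod ρ = ∫ x, f x ^ 2 ∂ν + ∫ y, g y ^ 2 ∂ρ + c ^ 2 := by
  have hf1 : Integrable f ν := hf.integrable one_le_two
  have hg1 : Integrable g ρ := hg.integrable one_le_two
  have e : ∀ z : α × β, (f z.1 + g z.2 + c) ^ 2 =
      ((f z.1 ^ 2 + 2 * c * f z.1) + (g z.2 ^ 2 + 2 * c * g z.2) + c ^ 2) +
        2 * (f z.1 * g z.2) := fun z => by ring
  have i1 : Integrable (fun x => f x ^ 2 + 2 * c * f x) ν :=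
    hf.integrable_sq.add (hf1.const_mul _)
  have i2 : Integrable (fun x => g x ^ 2 + 2 * c * g x) ρ :=
    hg.integrable_sq.add (hg1.const_mul _)
  have i3 : Integrable (fun z : α × β =>
      (f z.1 ^ 2 + 2 * c * f z.1) + (g z.2 ^ 2 + 2 * c * g z.2) + c ^ 2) (ν.prod ρ) :=
    ((i1.comp_fst ρ).add (i2.comp_snd ν)).add (integrable_const _)
  simp only [e]
  rw [integral_add i3 ((hf1.mul_prod hg1).const_mul 2), integral_add_add_prod i1 i2, integral_const_mul,
    integral_prod_mul, hf0, integral_add hf.integrable_sq (hf1.const_mul _),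
    integral_add hg.integrable_sq (hg1.const_mul _), integral_const_mul, integral_const_mul,
    hf0, hg0]
  ring

/-- The linear combination `a x + b y` of the coordinates of a pair. -/
def linComb (a b : ℝ) (x : ℕ × ℕ) : ℝ := a * x.1 + b * x.2

/-- Mean of `a S_n + b K_n`. -/
noncomputable def meanLin (μ : ℕ → Measure (ℕ × ℕ)) (a b : ℝ) (n : ℕ) : ℝ := a * eS μ n + b * eK μ n

/-- Variance of `a S_n + b K_n`. -/
noncomputable def varLin (μ : ℕ → Measure (ℕ × ℕ)) (a b : ℝ) (n : ℕ) : ℝ :=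
  ∫ x, (linComb a b x - meanLin μ a b n) ^ 2 ∂μ n

/-- Characteristic function at `(a, b)` of the centered pair `(S_n, K_n)`. -/
noncomputable def charLin (μ : ℕ → Measure (ℕ × ℕ)) (a b : ℝ) (n : ℕ) : ℂ :=
  ∫ x, Complex.exp (Complex.I * (linComb a b x - meanLin μ a b n : ℝ)) ∂μ n

lemma linComb_trieJoin (a b : ℝ) (n : ℕ) (z : (ℕ × ℕ) × (ℕ × ℕ)) :
    linComb a b (trieJoin n z) = linComb a b z.1 + linComb a b z.2 + (a + b * n) := by
  simp only [linComb, trieJoin]; push_cast; ring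

lemma varLin_nonneg (μ : ℕ → Measure (ℕ × ℕ)) (a b : ℝ) (n : ℕ) : 0 ≤ varLin μ a b n :=
  integral_nonneg fun _ => sq_nonneg _

namespace IsTriePairFamily

variable {p : ℝ} {μ : ℕ → Measure (ℕ × ℕ)}

lemma memLp_two_of_le (h : IsTriePairFamily p μ) (n : ℕ) {f : ℕ × ℕ → ℝ}
    (hf : ∀ x, |f x| ≤ x.1 + x.2) : MemLp f 2 (μ n) := by
  have hg : MemLp (fun x : ℕ × ℕ => (x.1 : ℝ) + x.2) 2 (μ n) :=
    (memLp_two_iff_integrable_sq .of_discrete).2 (h.moments n 2)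
  refine hg.mono .of_discrete (.of_forall fun x => ?_)
  rw [Real.norm_eq_abs, Real.norm_eq_abs]
  exact (hf x).trans (le_abs_self _)

lemma memLp_fst (h : IsTriePairFamily p μ) (n : ℕ) :
    MemLp (fun x : ℕ × ℕ => (x.1 : ℝ)) 2 (μ n) :=
  h.memLp_two_of_le n fun x => by rw [Nat.abs_cast]; simp

lemma memLp_snd (h : IsTriePairFamily p μ) (n : ℕ) :
    MemLp (fun x : ℕ × ℕ => (x.2 : ℝ)) 2 (μ n) :=
  h.memLp_two_of_le n fun x => by rw [Nat.abs_cast]; simp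

lemma memLp_linComb (h : IsTriePairFamily p μ) (a b : ℝ) (n : ℕ) : MemLp (linComb a b) 2 (μ n) :=
  ((h.memLp_fst n).const_mul a).add ((h.memLp_snd n).const_mul b)

lemma memLp_linComb_sub (h : IsTriePairFamily p μ) (a b : ℝ) (n : ℕ) :
    MemLp (fun x => linComb a b x - meanLin μ a b n) 2 (μ n) := by
  have := h.prob n
  exact (h.memLp_linComb a b n).sub (memLp_const _)

lemma integral_linComb (h : IsTriePairFamily p μ) (a b : ℝ) (n : ℕ) :
    ∫ x, linComb a b x ∂μ n = meanLin μ a b n := by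
  have := h.prob n
  simp only [linComb]
  rw [integral_add (((h.memLp_fst n).integrable one_le_two).const_mul a)
    (((h.memLp_snd n).integrable one_le_two).const_mul b), integral_const_mul, integral_const_mul]
  rfl

lemma integral_linComb_sub (h : IsTriePairFamily p μ) (a b : ℝ) (n : ℕ) :
    ∫ x, (linComb a b x - meanLin μ a b n) ∂μ n = 0 := by
  have := h.prob n
  rw [integral_sub ((h.memLp_linComb a b n).integrable one_le_two) (integrable_const _),
    h.integral_linComb]
  simp

lemma meanLin_rec (h : IsTriePairFamily p μ) (hp0 : 0 ≤ p) (hp1 : p ≤ 1) (a b : ℝ) {n : ℕ}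
    (hn : 2 ≤ n) : meanLin μ a b n =
      binE p n (fun k => meanLin μ a b k + meanLin μ a b (n - k)) + (a + b * n) := by
  have := h.prob n
  rw [← h.integral_linComb,
    h.integral_eq_binE hp0 hp1 hn ((h.memLp_linComb a b n).integrable one_le_two),
    ← binE_const p n (a + b * n), ← binE_add]
  refine binE_congr fun k _ => ?_
  have := h.prob k
  have := h.prob (n - k)
  simp only [linComb_trieJoin]
  rw [integral_add_add_prod ((h.memLp_linComb a b k).integrable one_le_two)
    ((h.memLp_linComb a b (n - k)).integrable one_le_two), h.integral_linComb, h.integral_linComb]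

lemma linComb_trieJoin_sub (h : IsTriePairFamily p μ) (hp0 : 0 ≤ p) (hp1 : p ≤ 1) (a b : ℝ) {n : ℕ}
    (hn : 2 ≤ n) (k : ℕ) (z : (ℕ × ℕ) × (ℕ × ℕ)) :
    linComb a b (trieJoin n z) - meanLin μ a b n =
      (linComb a b z.1 - meanLin μ a b k) + (linComb a b z.2 - meanLin μ a b (n - k)) +
        (meanLin μ a b k + meanLin μ a b (n - k) -
          binE p n (fun k => meanLin μ a b k + meanLin μ a b (n - k))) := by
  rw [linComb_trieJoin, h.meanLin_rec hp0 hp1 a b hn]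
  ring

lemma varLin_rec (h : IsTriePairFamily p μ) (hp0 : 0 ≤ p) (hp1 : p ≤ 1) (a b : ℝ) {n : ℕ}
    (hn : 2 ≤ n) : varLin μ a b n =
      binE p n (fun k => varLin μ a b k + varLin μ a b (n - k)) + tollVar p (meanLin μ a b) n := by
  rw [tollVar_eq, ← binE_add, varLin,
    h.integral_eq_binE hp0 hp1 hn (h.memLp_linComb_sub a b n).integrable_sq]
  refine binE_congr fun k _ => ?_
  have := h.prob k
  have := h.prob (n - k)
  simp only [h.linComb_trieJoin_sub hp0 hp1 a b hn k]
  rw [integral_add_add_sq_prod (h.memLp_linComb_sub a b k) (h.memLp_linComb_sub a b (n - k))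
    (h.integral_linComb_sub a b k) (h.integral_linComb_sub a b (n - k))]
  rfl

lemma charLin_rec (h : IsTriePairFamily p μ) (hp0 : 0 ≤ p) (hp1 : p ≤ 1) (a b : ℝ) {n : ℕ}
    (hn : 2 ≤ n) : charLin μ a b n =
      binE p n (fun k => charLin μ a b k * charLin μ a b (n - k) *
        Complex.exp (Complex.I * (meanLin μ a b k + meanLin μ a b (n - k) -
          binE p n (fun k => meanLin μ a b k + meanLin μ a b (n - k)) : ℝ))) := by
  have := h.prob n
  have hi : Integrable
      (fun x => Complex.exp (Complex.I * (linComb a b x - meanLin μ a b n : ℝ))) (μ n) :=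
    (integrable_const (1 : ℝ)).mono .of_discrete (.of_forall fun x => by
      rw [norm_cexp_I, norm_one])
  rw [charLin, h.integral_eq_binE hp0 hp1 hn hi]
  refine binE_congr fun k _ => ?_
  have := h.prob k
  have := h.prob (n - k)
  simp only [h.linComb_trieJoin_sub hp0 hp1 a b hn k]
  rw [charLin, charLin, ← integral_prod_mul, ← integral_mul_const]
  refine integral_congr_ae (.of_forall fun z => ?_)
  simp only
  rw [← Complex.exp_add, ← Complex.exp_add]
  congr 1
  push_cast
  ring

lemma norm_charLin_le (h : IsTriePairFamily p μ) (a b : ℝ) (n : ℕ) : ‖charLin μ a b n‖ ≤ 1 := by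
  have := h.prob n
  refine (norm_integral_le_integral_norm _).trans ?_
  simp only [norm_cexp_I]
  simp

lemma meanLin_zero (h : IsTriePairFamily p μ) (a b : ℝ) : meanLin μ a b 0 = 0 := by
  simp [meanLin, eS, eK, h.init0]

lemma meanLin_one (h : IsTriePairFamily p μ) (a b : ℝ) : meanLin μ a b 1 = 0 := by
  simp [meanLin, eS, eK, h.init1]

lemma varLin_zero (h : IsTriePairFamily p μ) (a b : ℝ) : varLin μ a b 0 = 0 := by
  simp [varLin, h.meanLin_zero, h.init0, linComb]

lemma varLin_one (h : IsTriePairFamily p μ) (a b : ℝ) : varLin μ a b 1 = 0 := by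
  simp [varLin, h.meanLin_one, h.init1, linComb]

lemma charLin_zero (h : IsTriePairFamily p μ) (a b : ℝ) : charLin μ a b 0 = 1 := by
  simp [charLin, h.meanLin_zero, h.init0, linComb]

lemma charLin_one (h : IsTriePairFamily p μ) (a b : ℝ) : charLin μ a b 1 = 1 := by
  simp [charLin, h.meanLin_one, h.init1, linComb]

lemma varLin_eq (h : IsTriePairFamily p μ) (a b : ℝ) (n : ℕ) : varLin μ a b n =
    a ^ 2 * varS μ n + 2 * (a * b) * covSK μ n + b ^ 2 * varK μ n := by
  have := h.prob n
  have hS : MemLp (fun x : ℕ × ℕ => (x.1 : ℝ) - eS μ n) 2 (μ n) :=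
    (h.memLp_fst n).sub (memLp_const _)
  have hK : MemLp (fun x : ℕ × ℕ => (x.2 : ℝ) - eK μ n) 2 (μ n) :=
    (h.memLp_snd n).sub (memLp_const _)
  have hSK : Integrable (fun x : ℕ × ℕ => ((x.1 : ℝ) - eS μ n) * ((x.2 : ℝ) - eK μ n)) (μ n) :=
    hS.integrable_mul hK
  have e : ∀ x : ℕ × ℕ, (linComb a b x - meanLin μ a b n) ^ 2 =
      a ^ 2 * ((x.1 : ℝ) - eS μ n) ^ 2 +
        2 * (a * b) * (((x.1 : ℝ) - eS μ n) * ((x.2 : ℝ) - eK μ n)) +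
        b ^ 2 * ((x.2 : ℝ) - eK μ n) ^ 2 := fun x => by simp only [linComb, meanLin]; ring
  have i : Integrable (fun x : ℕ × ℕ => a ^ 2 * ((x.1 : ℝ) - eS μ n) ^ 2 +
      2 * (a * b) * (((x.1 : ℝ) - eS μ n) * ((x.2 : ℝ) - eK μ n))) (μ n) :=
    (hS.integrable_sq.const_mul _).add (hSK.const_mul _)
  rw [varLin]
  simp only [e]
  rw [integral_add i (hK.integrable_sq.const_mul _), integral_add (hS.integrable_sq.const_mul _) (hSK.const_mul _),
    integral_const_mul, integral_const_mul, integral_const_mul]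
  rfl

end IsTriePairFamily

namespace IsTriePairFamily

variable {p : ℝ} {μ : ℕ → Measure (ℕ × ℕ)}

lemma exists_second_diff_meanLin_le (h : IsTriePairFamily p μ) (hp0 : 0 < p) (hp1 : p < 1) :
    ∃ C, 1 ≤ C ∧ ∀ a b : ℝ, ∀ n : ℕ,
      |meanLin μ a b (n + 2) - 2 * meanLin μ a b (n + 1) + meanLin μ a b n| ≤
        C * (|a| + |b|) / (n + 1) := by
  have hS : ∀ n, 2 ≤ n → eS μ n = binE p n (fun k => eS μ k + eS μ (n - k)) + (1 + 0 * (n : ℝ)) :=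
    fun n hn => by simpa [meanLin] using h.meanLin_rec hp0.le hp1.le 1 0 hn
  have hK : ∀ n, 2 ≤ n → eK μ n = binE p n (fun k => eK μ k + eK μ (n - k)) + (0 + 1 * (n : ℝ)) :=
    fun n hn => by simpa [meanLin] using h.meanLin_rec hp0.le hp1.le 0 1 hn
  obtain ⟨C₁, hC₁, H₁⟩ := second_diff_le hp0 hp1 hS
  obtain ⟨C₂, hC₂, H₂⟩ := second_diff_le hp0 hp1 hK
  refine ⟨C₁ + C₂ + 1, by linarith, fun a b n => ?_⟩
  have e : meanLin μ a b (n + 2) - 2 * meanLin μ a b (n + 1) + meanLin μ a b n =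
      a * (eS μ (n + 2) - 2 * eS μ (n + 1) + eS μ n) +
        b * (eK μ (n + 2) - 2 * eK μ (n + 1) + eK μ n) := by simp only [meanLin]; ring
  rw [e]
  refine (abs_add_le _ _).trans ?_
  rw [abs_mul, abs_mul]
  have hn : (0 : ℝ) < n + 1 := by positivity
  refine (add_le_add (mul_le_mul_of_nonneg_left (H₁ n) (abs_nonneg a))
    (mul_le_mul_of_nonneg_left (H₂ n) (abs_nonneg b))).trans ?_
  rw [← mul_div_assoc, ← mul_div_assoc, ← add_div, div_le_div_iff_of_pos_right hn]
  nlinarith [mul_nonneg (abs_nonneg a) hC₂, mul_nonneg (abs_nonneg b) hC₁, abs_nonneg a,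
    abs_nonneg b]

lemma varLin_le (h : IsTriePairFamily p μ) (a b : ℝ) (n : ℕ) :
    varLin μ a b n ≤ (|varS μ n| + 2 * |covSK μ n| + |varK μ n|) * (|a| + |b|) ^ 2 := by
  rw [h.varLin_eq]
  have h1 : a ^ 2 * varS μ n ≤ |a| ^ 2 * |varS μ n| := by
    rw [sq_abs]; exact mul_le_mul_of_nonneg_left (le_abs_self _) (sq_nonneg _)
  have h2 : a * b * covSK μ n ≤ |a| * |b| * |covSK μ n| := by
    rw [← abs_mul, ← abs_mul]; exact le_abs_self _
  have h3 : b ^ 2 * varK μ n ≤ |b| ^ 2 * |varK μ n| := by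
    rw [sq_abs]; exact mul_le_mul_of_nonneg_left (le_abs_self _) (sq_nonneg _)
  have ha := abs_nonneg a
  have hb := abs_nonneg b
  have e1 : |a| ^ 2 ≤ (|a| + |b|) ^ 2 := by gcongr; linarith
  have e2 : |a| * |b| ≤ (|a| + |b|) ^ 2 := by nlinarith [mul_nonneg ha hb]
  have e3 : |b| ^ 2 ≤ (|a| + |b|) ^ 2 := by gcongr; linarith
  nlinarith [mul_le_mul_of_nonneg_right e1 (abs_nonneg (varS μ n)),
    mul_le_mul_of_nonneg_right e2 (abs_nonneg (covSK μ n)),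
    mul_le_mul_of_nonneg_right e3 (abs_nonneg (varK μ n))]

lemma exists_norm_charLin_sub_le (h : IsTriePairFamily p μ) (hp0 : 0 < p) (hp1 : p < 1) {M : ℝ}
    (hM : 0 ≤ M) : ∃ C, 0 ≤ C ∧ ∀ (a b : ℝ) (n : ℕ), (|a| + |b|) ^ 2 * n ≤ M →
      ‖charLin μ a b n - (Real.exp (-(varLin μ a b n / 2)) : ℝ)‖ ≤
        C * ((|a| + |b|) ^ 3 * (n : ℝ) ^ (5 / 4 : ℝ)) := by
  obtain ⟨D, hD, HD⟩ := h.exists_second_diff_meanLin_le hp0 hp1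
  set B := |varS μ 2| + 2 * |covSK μ 2| + |varK μ 2| with hB
  have hpq : 0 < p * (1 - p) := mul_pos hp0 (by linarith)
  obtain ⟨C, hC, HC⟩ := exists_norm_charFun_sub_le hp0 hp1
    (A := 40000 / (p * (1 - p)) + B) (M := D ^ 2 * M) (by positivity) (by positivity)
  refine ⟨C * D ^ 3, by positivity, fun a b n hn => ?_⟩
  set r := |a| + |b| with hr
  have hr0 : 0 ≤ r := by positivity
  have hrD : r ≤ D * r := by nlinarith
  have hV2 : |varLin μ a b 2| ≤ B * (D * r) ^ 2 := by
    rw [abs_of_nonneg (varLin_nonneg _ _ _ _)]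
    refine (h.varLin_le a b 2).trans ?_
    gcongr
  refine (HC (D * r) (meanLin μ a b) (varLin μ a b) (charLin μ a b) (by positivity) (HD a b)
    (fun k => ?_) (varLin_nonneg μ a b) (h.varLin_zero a b) (h.varLin_one a b) (h.charLin_zero a b)
    (h.charLin_one a b) (h.norm_charLin_le a b) (fun k hk => h.varLin_rec hp0.le hp1.le a b hk)
    (fun k hk => h.charLin_rec hp0.le hp1.le a b hk) n ?_).trans_eq ?_
  · refine (abs_var_succ_sub_le hp0 hp1 (by positivity) (h.meanLin_zero a b) (h.meanLin_one a b)
      (HD a b) (h.varLin_zero a b) (h.varLin_one a b)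
      (fun k hk => h.varLin_rec hp0.le hp1.le a b hk) k).trans ?_
    refine mul_le_mul_of_nonneg_right ?_ (by positivity)
    rw [add_mul]
    gcongr
  · rw [mul_pow, mul_assoc]
    gcongr
  · ring

lemma exists_varLin_ge (h : IsTriePairFamily p μ) (hp0 : 0 < p) (hp1 : p < 1) :
    ∃ c, 0 < c ∧ ∀ (a b : ℝ) (n : ℕ), 16 ≤ n → c * (|a| + |b|) ^ 2 * n ≤ varLin μ a b n := by
  obtain ⟨c, hc, H⟩ := exists_var_ge hp0 hp1
  exact ⟨c, hc, fun a b n hn => H a b (meanLin μ a b) (varLin μ a b) (h.meanLin_zero a b)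
    (h.meanLin_one a b) (h.varLin_zero a b) (h.varLin_one a b) (varLin_nonneg μ a b)
    (fun k hk => h.meanLin_rec hp0.le hp1.le a b hk)
    (fun k hk => h.varLin_rec hp0.le hp1.le a b hk) n hn⟩

lemma posDef_cov (h : IsTriePairFamily p μ) (hp0 : 0 < p) (hp1 : p < 1) {n : ℕ} (hn : 16 ≤ n) :
    (!![varS μ n, covSK μ n; covSK μ n, varK μ n] : Matrix (Fin 2) (Fin 2) ℝ).PosDef := by
  obtain ⟨c, hc, H⟩ := h.exists_varLin_ge hp0 hp1
  refine Matrix.PosDef.of_dotProduct_mulVec_pos ?_ fun x hx => ?_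
  · ext i j
    fin_cases i <;> fin_cases j <;> simp
  · have hV := H (x 0) (x 1) n hn
    have hr : 0 < |x 0| + |x 1| := by
      by_contra! hle
      have h0 : |x 0| = 0 := le_antisymm (by linarith [abs_nonneg (x 1)]) (abs_nonneg _)
      have h1 : |x 1| = 0 := le_antisymm (by linarith [abs_nonneg (x 0)]) (abs_nonneg _)
      apply hx
      ext i
      fin_cases i
      · exact abs_eq_zero.1 h0
      · exact abs_eq_zero.1 h1
    have hn0 : (0 : ℝ) < n := by exact_mod_cast (by omega : 0 < n)
    have hpos : 0 < varLin μ (x 0) (x 1) n := lt_of_lt_of_le (by positivity) hV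
    rw [h.varLin_eq] at hpos
    refine hpos.trans_eq ?_
    simp [Matrix.mulVec, dotProduct, Fin.sum_univ_two]
    ring

end IsTriePairFamily

lemma tendsto_integral_of_tendsto_integral_cexp {ν : ℕ → Measure (ℝ × ℝ)} {ρ : Measure (ℝ × ℝ)}
    [∀ n, IsProbabilityMeasure (ν n)] [IsProbabilityMeasure ρ]
    (H : ∀ s t : ℝ, Tendsto
      (fun n => ∫ x, Complex.exp (Complex.I * (s * x.1 + t * x.2 : ℝ)) ∂ν n) atTop
      (𝓝 (∫ x, Complex.exp (Complex.I * (s * x.1 + t * x.2 : ℝ)) ∂ρ)))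
    (f : BoundedContinuousFunction (ℝ × ℝ) ℝ) :
    Tendsto (fun n => ∫ x, f x ∂ν n) atTop (𝓝 (∫ x, f x ∂ρ)) := by
  have hm : Measurable (WithLp.toLp 2 : ℝ × ℝ → WithLp 2 (ℝ × ℝ)) := by fun_prop
  have key : ∀ (κ : Measure (ℝ × ℝ)) (u : WithLp 2 (ℝ × ℝ)), charFun (κ.map (WithLp.toLp 2)) u =
      ∫ x, Complex.exp (Complex.I * (u.fst * x.1 + u.snd * x.2 : ℝ)) ∂κ := fun κ u => by
    rw [charFun_apply, integral_map hm.aemeasurable (by fun_prop)]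
    refine integral_congr_ae (.of_forall fun x => ?_)
    simp only [WithLp.prod_inner_apply]
    rw [mul_comm]
    simp
  let ν' : ℕ → ProbabilityMeasure (WithLp 2 (ℝ × ℝ)) := fun n =>
    ⟨(ν n).map (WithLp.toLp 2), Measure.isProbabilityMeasure_map hm.aemeasurable⟩
  let ρ' : ProbabilityMeasure (WithLp 2 (ℝ × ℝ)) :=
    ⟨ρ.map (WithLp.toLp 2), Measure.isProbabilityMeasure_map hm.aemeasurable⟩
  have hconv : Tendsto ν' atTop (𝓝 ρ') := by
    refine ProbabilityMeasure.tendsto_of_tendsto_charFun fun u => ?_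
    simp only [ν', ρ', ProbabilityMeasure.coe_mk, key]
    exact H u.fst u.snd
  have hf := ProbabilityMeasure.tendsto_iff_forall_integral_tendsto.1 hconv
    (f.compContinuous ⟨WithLp.ofLp, by fun_prop⟩)
  have hi : ∀ κ : Measure (ℝ × ℝ), ∫ x, f.compContinuous ⟨WithLp.ofLp, by fun_prop⟩ x
      ∂(κ.map (WithLp.toLp 2 : ℝ × ℝ → WithLp 2 (ℝ × ℝ))) = ∫ x, f x ∂κ := fun κ => by
    rw [integral_map hm.aemeasurable
      (BoundedContinuousFunction.continuous _).measurable.aestronglyMeasurable]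
    rfl
  simpa only [ν', ρ', ProbabilityMeasure.coe_mk, hi] using hf

lemma integral_cexp_gaussianReal_prod (s t : ℝ) :
    ∫ x, Complex.exp (Complex.I * (s * x.1 + t * x.2 : ℝ))
      ∂(gaussianReal 0 1).prod (gaussianReal 0 1) = (Real.exp (-((s ^ 2 + t ^ 2) / 2)) : ℝ) := by
  have e : ∀ u : ℝ, ∫ x, Complex.exp (Complex.I * (u * x : ℝ)) ∂gaussianReal 0 1 =
      (Real.exp (-(u ^ 2 / 2)) : ℝ) := fun u => by
    have := charFun_gaussianReal (μ := 0) (v := 1) u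
    rw [charFun_apply_real] at this
    push_cast at this ⊢
    convert this using 3
    · ring_nf
    · simp
  have e2 : -((s ^ 2 + t ^ 2) / 2) = -(s ^ 2 / 2) + -(t ^ 2 / 2) := by ring
  rw [e2, Real.exp_add, Complex.ofReal_mul, ← e, ← e, ← integral_prod_mul]
  refine integral_congr_ae (.of_forall fun x => ?_)
  simp only
  rw [← Complex.exp_add]
  push_cast
  ring_nf

lemma quadForm_inv_sqrt {R : Matrix (Fin 2) (Fin 2) ℝ} {v c w : ℝ} (hR : R.PosDef)
    (h : R * R = !![v, c; c, w]) (s t : ℝ) :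
    (s * R⁻¹ 0 0 + t * R⁻¹ 1 0) ^ 2 * v +
        2 * ((s * R⁻¹ 0 0 + t * R⁻¹ 1 0) * (s * R⁻¹ 0 1 + t * R⁻¹ 1 1)) * c +
      (s * R⁻¹ 0 1 + t * R⁻¹ 1 1) ^ 2 * w = s ^ 2 + t ^ 2 := by
  have hQ : R⁻¹ * R = 1 := Matrix.nonsing_inv_mul _ hR.det_pos.ne'.isUnit
  have hs : R 1 0 = R 0 1 := by simpa using hR.isHermitian.apply 0 1
  have q00 := congrFun₂ hQ 0 0
  have q01 := congrFun₂ hQ 0 1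
  have q10 := congrFun₂ hQ 1 0
  have q11 := congrFun₂ hQ 1 1
  have r00 := congrFun₂ h 0 0
  have r01 := congrFun₂ h 0 1
  have r11 := congrFun₂ h 1 1
  simp only [Matrix.mul_apply, Fin.sum_univ_two, Matrix.one_apply, hs, Matrix.of_apply,
    Matrix.cons_val', Matrix.cons_val_zero, Matrix.cons_val_one, Matrix.cons_val_fin_one,
    if_true, zero_ne_one, one_ne_zero, if_false] at q00 q01 q10 q11 r00 r01 r11
  set a := s * R⁻¹ 0 0 + t * R⁻¹ 1 0 with ha
  set b := s * R⁻¹ 0 1 + t * R⁻¹ 1 1 with hb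
  have h1 : a * R 0 0 + b * R 0 1 = s := by
    rw [ha, hb]; linear_combination s * q00 + t * q10
  have h2 : a * R 0 1 + b * R 1 1 = t := by
    rw [ha, hb]; linear_combination s * q01 + t * q11
  rw [← r00, ← r01, ← r11, ← h1, ← h2]
  ring

lemma pow_three_mul_rpow_le {r K x : ℝ} (hr : 0 ≤ r) (hx : 0 < x) (hK : 0 ≤ K)
    (h : r ^ 2 * x ≤ K ^ 2) : r ^ 3 * x ^ (5 / 4 : ℝ) ≤ K ^ 3 * x ^ (-(1 / 4) : ℝ) := by
  have h1 : r * √x ≤ K := by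
    refine abs_le_of_sq_le_sq' ?_ hK |>.2
    rwa [mul_pow, Real.sq_sqrt hx.le]
  have h2 : x ^ (5 / 4 : ℝ) = √x ^ 3 * x ^ (-(1 / 4) : ℝ) := by
    rw [Real.sqrt_eq_rpow, ← Real.rpow_natCast, ← Real.rpow_mul hx.le, ← Real.rpow_add hx]
    norm_num
  rw [h2, ← mul_assoc, ← mul_pow]
  gcongr

namespace IsTriePairFamily

variable {p : ℝ} {μ : ℕ → Measure (ℕ × ℕ)}

lemma tendsto_charLin (h : IsTriePairFamily p μ) (hp0 : 0 < p) (hp1 : p < 1) {W : ℝ} (hW : 0 ≤ W)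
    {a b : ℕ → ℝ} (hV : ∀ᶠ n in atTop, varLin μ (a n) (b n) n = W) :
    Tendsto (fun n => charLin μ (a n) (b n) n) atTop (𝓝 (Real.exp (-(W / 2)) : ℝ)) := by
  obtain ⟨c, hc, Hc⟩ := h.exists_varLin_ge hp0 hp1
  obtain ⟨C, hC, HC⟩ := h.exists_norm_charLin_sub_le hp0 hp1 (M := W / c) (by positivity)
  have hlim : Tendsto (fun n : ℕ => C * (√(W / c) ^ 3 * (n : ℝ) ^ (-(1 / 4) : ℝ))) atTop (𝓝 0) := by
    have := (tendsto_rpow_neg_atTop (show (0 : ℝ) < 1 / 4 by norm_num)).comp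
      tendsto_natCast_atTop_atTop
    simpa using (this.const_mul (√(W / c) ^ 3)).const_mul C
  rw [tendsto_iff_norm_sub_tendsto_zero]
  refine squeeze_zero' (.of_forall fun n => norm_nonneg _) ?_ hlim
  filter_upwards [hV, eventually_ge_atTop 16] with n hn hn16
  have hn0 : (0 : ℝ) < n := by exact_mod_cast (by omega : 0 < n)
  have hle : (|a n| + |b n|) ^ 2 * n ≤ W / c := by
    rw [le_div_iff₀ hc]
    have := Hc (a n) (b n) n hn16
    rw [hn] at this
    linarith
  have := HC (a n) (b n) n hle
  rw [hn] at this
  refine this.trans (mul_le_mul_of_nonneg_left ?_ hC)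
  refine pow_three_mul_rpow_le (by positivity) hn0 (Real.sqrt_nonneg _) ?_
  rwa [Real.sq_sqrt (by positivity)]

end IsTriePairFamily

/-- the covariance matrix `Σ̂_n` of `(S_n, K_n)` is eventually positive
definite, and `Σ̂_n^{-1/2}(S_n - E S_n, K_n - E K_n)ᵀ` converges in distribution to a
centered bivariate Gaussian with identity covariance matrix. -/
theorem stmt5 (p : ℝ) (hp0 : 0 < p) (hp1 : p < 1)
    (μ : ℕ → Measure (ℕ × ℕ)) (hμ : IsTriePairFamily p μ) :
    (∃ N : ℕ, ∀ n ≥ N,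
      (!![varS μ n, covSK μ n; covSK μ n, varK μ n] : Matrix (Fin 2) (Fin 2) ℝ).PosDef) ∧
    ∀ R : ℕ → Matrix (Fin 2) (Fin 2) ℝ,
      (∀ᶠ n in atTop, (R n).PosDef ∧
        R n * R n = !![varS μ n, covSK μ n; covSK μ n, varK μ n]) →
      ∀ f : BoundedContinuousFunction (ℝ × ℝ) ℝ,
        Tendsto (fun n : ℕ => ∫ x, f x ∂ ((μ n).map (fun x : ℕ × ℕ =>
            ((R n)⁻¹ 0 0 * ((x.1 : ℝ) - eS μ n) + (R n)⁻¹ 0 1 * ((x.2 : ℝ) - eK μ n),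
             (R n)⁻¹ 1 0 * ((x.1 : ℝ) - eS μ n) + (R n)⁻¹ 1 1 * ((x.2 : ℝ) - eK μ n)))))
          atTop (𝓝 (∫ x, f x ∂ ((gaussianReal 0 1).prod (gaussianReal 0 1)))) := by
  refine ⟨⟨16, fun n hn => hμ.posDef_cov hp0 hp1 hn⟩, fun R hR f => ?_⟩
  have hprob := hμ.prob
  have : ∀ n, IsProbabilityMeasure ((μ n).map (fun x : ℕ × ℕ =>
      ((R n)⁻¹ 0 0 * ((x.1 : ℝ) - eS μ n) + (R n)⁻¹ 0 1 * ((x.2 : ℝ) - eK μ n),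
       (R n)⁻¹ 1 0 * ((x.1 : ℝ) - eS μ n) + (R n)⁻¹ 1 1 * ((x.2 : ℝ) - eK μ n)))) := fun n =>
    Measure.isProbabilityMeasure_map Measurable.of_discrete.aemeasurable
  refine tendsto_integral_of_tendsto_integral_cexp (fun s t => ?_) f
  rw [integral_cexp_gaussianReal_prod]
  refine (hμ.tendsto_charLin hp0 hp1 (W := s ^ 2 + t ^ 2) (by positivity)
    (a := fun n => s * (R n)⁻¹ 0 0 + t * (R n)⁻¹ 1 0)
    (b := fun n => s * (R n)⁻¹ 0 1 + t * (R n)⁻¹ 1 1) ?_).congr fun n => ?_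
  · filter_upwards [hR] with n hn
    rw [hμ.varLin_eq, quadForm_inv_sqrt hn.1 hn.2]
  · rw [integral_map Measurable.of_discrete.aemeasurable (by fun_prop), charLin]
    refine integral_congr_ae (.of_forall fun x => ?_)
    simp only [linComb, meanLin]
    congr 3
    ring
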